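/- arXiv:2311.15666 — 2 statements merged into one kernel-verified Lean document; each statement's English description precedes it below -/
import Mathlib

section
/- Σ_{n=0}^∞ (−1)^n (2n+1)^5 / cosh((2n+1)π/2)^3 = −3Γ^12/(2^9 π^9) + 5Γ^12/(2^8 π^10), where Γ = Γ(1/4). -/
open Real

namespace HyperbolicSeries

open Filter Topology

/-! ### Summability and trigonometric series -/

lemma summable_int_pow_mul_exp_neg {c : ℝ} (hc : 0 < c) (k : ℕ) :
    Summable fun n : ℤ => |(n : ℝ)| ^ k * exp (-c * |(n : ℝ)|) := by
  have h := Real.summable_pow_mul_exp_neg_nat_mul k hc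
  apply Summable.of_nat_of_neg <;> simpa using h

lemma inv_cosh_le (x : ℝ) : 1 / cosh x ≤ 2 * exp (-|x|) := by
  rw [div_le_iff₀ (cosh_pos x), ← cosh_abs, cosh_eq, exp_neg]
  have := exp_pos |x|
  field_simp
  nlinarith [exp_pos |x|]

lemma summable_pow_div_cosh {y : ℝ} (hy : 0 < y) (k : ℕ) :
    Summable fun j : ℤ => |2 * (j : ℝ) + 1| ^ k / cosh ((2 * j + 1) * y) := by
  have h : Summable fun n : ℤ => 2 * (|(n : ℝ)| ^ k * exp (-y * |(n : ℝ)|)) :=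
    (summable_int_pow_mul_exp_neg hy k).mul_left 2
  have hinj : Function.Injective fun j : ℤ => 2 * j + 1 := fun a b hab => by
    simp only at hab; omega
  refine Summable.of_nonneg_of_le (fun j => ?_) (fun j => ?_) (h.comp_injective hinj)
  · have := cosh_pos ((2 * (j : ℝ) + 1) * y)
    positivity
  · have h1 := inv_cosh_le ((2 * (j : ℝ) + 1) * y)
    rw [abs_mul, abs_of_pos hy] at h1
    have h2 := mul_le_mul_of_nonneg_left h1 (by positivity : 0 ≤ |2 * (j : ℝ) + 1| ^ k)
    simp only [Function.comp]
    push_cast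
    calc _ = |2 * (j : ℝ) + 1| ^ k * (1 / cosh ((2 * j + 1) * y)) := by ring
      _ ≤ _ := h2
      _ = _ := by ring_nf

lemma summable_pow_div_sinh {y : ℝ} (hy : 0 < y) (k : ℕ) :
    Summable fun m : ℤ => |2 * (m : ℝ)| ^ k / |sinh (2 * m * y)| := by
  have h : Summable fun n : ℤ => 2 ^ k / y * (|(n : ℝ)| ^ k * exp (-y * |(n : ℝ)|)) :=
    (summable_int_pow_mul_exp_neg hy k).mul_left _
  refine Summable.of_nonneg_of_le (fun j => by positivity) (fun m => ?_) h
  rcases eq_or_ne m 0 with rfl | hm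
  · simp
    positivity
  · have hm1 : (1 : ℝ) ≤ |(m : ℝ)| := by exact_mod_cast Int.one_le_abs hm
    have e1 : |sinh (2 * m * y)| = 2 * sinh (|(m : ℝ)| * y) * cosh (|(m : ℝ)| * y) := by
      rw [abs_sinh, ← sinh_two_mul, abs_mul, abs_mul, abs_of_pos hy]
      simp [mul_assoc]
    have h2 : y ≤ sinh (|(m : ℝ)| * y) :=
      le_trans (by nlinarith) (self_le_sinh_iff.2 (by positivity : 0 ≤ |(m : ℝ)| * y))
    have h3 := inv_cosh_le (|(m : ℝ)| * y)
    rw [abs_of_nonneg (by positivity : 0 ≤ |(m : ℝ)| * y)] at h3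
    have hc := cosh_pos (|(m : ℝ)| * y)
    have e3 : -y * |(m : ℝ)| = -(|(m : ℝ)| * y) := by ring
    rw [e1, abs_mul, mul_pow, abs_two, e3]
    calc 2 ^ k * |(m : ℝ)| ^ k / (2 * sinh (|(m : ℝ)| * y) * cosh (|(m : ℝ)| * y))
        ≤ 2 ^ k * |(m : ℝ)| ^ k / (2 * y * cosh (|(m : ℝ)| * y)) := by gcongr
      _ = 2 ^ k * |(m : ℝ)| ^ k / (2 * y) * (1 / cosh (|(m : ℝ)| * y)) := by
        field_simp
      _ ≤ 2 ^ k * |(m : ℝ)| ^ k / (2 * y) * (2 * exp (-(|(m : ℝ)| * y))) := by gcongr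
      _ = _ := by field_simp

/-- The trigonometric series `∑ a j cos (φ j u)`. -/
noncomputable def cosSeries (φ a : ℤ → ℝ) (u : ℝ) : ℝ := ∑' j, a j * cos (φ j * u)

/-- The trigonometric series `∑ a j sin (φ j u)`. -/
noncomputable def sinSeries (φ a : ℤ → ℝ) (u : ℝ) : ℝ := ∑' j, a j * sin (φ j * u)

lemma summable_mul_cos {a : ℤ → ℝ} (ha : Summable a) (θ : ℤ → ℝ) :
    Summable fun j => a j * cos (θ j) := by
  refine Summable.of_norm_bounded ha.abs fun j => ?_
  rw [norm_mul, norm_eq_abs]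
  exact mul_le_of_le_one_right (abs_nonneg _) (abs_cos_le_one _)

lemma summable_mul_sin {a : ℤ → ℝ} (ha : Summable a) (θ : ℤ → ℝ) :
    Summable fun j => a j * sin (θ j) := by
  refine Summable.of_norm_bounded ha.abs fun j => ?_
  rw [norm_mul, norm_eq_abs]
  exact mul_le_of_le_one_right (abs_nonneg _) (abs_sin_le_one _)

lemma hasDerivAt_cosSeries {φ a : ℤ → ℝ} (ha : Summable a) (hb : Summable fun j => φ j * a j)
    (u : ℝ) : HasDerivAt (cosSeries φ a) (-sinSeries φ (fun j => φ j * a j) u) u := by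
  have := hasDerivAt_tsum (g := fun j u => a j * cos (φ j * u))
    (g' := fun j u => -(φ j * a j * sin (φ j * u))) hb.abs (fun j y => ?_) (fun j y => ?_)
    (summable_mul_cos ha fun j => φ j * 0) u
  · rw [tsum_neg] at this
    exact this
  · have := ((hasDerivAt_mul_const (x := y) (φ j)).cos).const_mul (a j)
    refine (this.congr_deriv ?_).congr_of_eventuallyEq (.of_forall fun x => ?_) <;> ring_nf
  · rw [norm_neg, norm_mul, norm_eq_abs]
    exact mul_le_of_le_one_right (abs_nonneg _) (abs_sin_le_one _)

lemma hasDerivAt_sinSeries {φ a : ℤ → ℝ} (ha : Summable a) (hb : Summable fun j => φ j * a j)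
    (u : ℝ) : HasDerivAt (sinSeries φ a) (cosSeries φ (fun j => φ j * a j) u) u := by
  refine hasDerivAt_tsum (g := fun j u => a j * sin (φ j * u))
    (g' := fun j u => φ j * a j * cos (φ j * u)) hb.abs (fun j y => ?_) (fun j y => ?_)
    (summable_mul_sin ha fun j => φ j * 0) u
  · have := ((hasDerivAt_mul_const (x := y) (φ j)).sin).const_mul (a j)
    refine (this.congr_deriv ?_).congr_of_eventuallyEq (.of_forall fun x => ?_) <;> ring_nf
  · rw [norm_mul, norm_eq_abs]
    exact mul_le_of_le_one_right (abs_nonneg _) (abs_cos_le_one _)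

lemma tsum_eq_zero_of_odd {f : ℤ → ℝ} (e : ℤ ≃ ℤ) (h : ∀ j, f (e j) = -f j) : ∑' j, f j = 0 := by
  have := e.tsum_eq f
  simp only [h, tsum_neg] at this
  linarith

/-- Reflection of the odd integers `2 j + 1`. -/
def oddNeg : ℤ ≃ ℤ := Equiv.subLeft (-1)

lemma oddNeg_cast (j : ℤ) : 2 * ((oddNeg j : ℤ) : ℝ) + 1 = -(2 * (j : ℝ) + 1) := by
  simp [oddNeg]; ring

/-- The shear `(n, j) ↦ (j, n - j)`. -/
def subShear : ℤ × ℤ ≃ ℤ × ℤ where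
  toFun p := (p.2, p.1 - p.2)
  invFun p := (p.1 + p.2, p.1)
  left_inv p := by simp
  right_inv p := by simp

/-- Product of trigonometric series as a convolution. -/
lemma cosSeries_mul_sub_sinSeries_mul {a b : ℤ → ℝ} (ha : Summable a) (hb : Summable b)
    (α β u : ℝ) :
    cosSeries (fun j => 2 * j + α) a u * cosSeries (fun j => 2 * j + β) b u
      - sinSeries (fun j => 2 * j + α) a u * sinSeries (fun j => 2 * j + β) b u
    = cosSeries (fun n => 2 * n + (α + β)) (fun n => ∑' j, a j * b (n - j)) u := by
  have hca := summable_mul_cos ha fun j => (2 * j + α) * u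
  have hcb := summable_mul_cos hb fun j => (2 * j + β) * u
  have hsa := summable_mul_sin ha fun j => (2 * j + α) * u
  have hsb := summable_mul_sin hb fun j => (2 * j + β) * u
  have hc := tsum_mul_tsum_of_summable_norm hca.norm hcb.norm
  have hs := tsum_mul_tsum_of_summable_norm hsa.norm hsb.norm
  have hC := summable_mul_of_summable_norm hca.norm hcb.norm
  have hS := summable_mul_of_summable_norm hsa.norm hsb.norm
  have hsub := hC.tsum_sub hS
  have hab : Summable fun p : ℤ × ℤ => a p.1 * b p.2 :=
    summable_mul_of_summable_norm ha.norm hb.norm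
  have key : Summable fun p : ℤ × ℤ => a p.1 * b p.2 * cos ((2 * (p.1 + p.2) + (α + β)) * u) := by
    refine Summable.of_norm_bounded hab.abs fun j => ?_
    rw [norm_mul, norm_eq_abs]
    exact mul_le_of_le_one_right (abs_nonneg _) (abs_cos_le_one _)
  have hcos : cosSeries (fun j => 2 * j + α) a u * cosSeries (fun j => 2 * j + β) b u
      - sinSeries (fun j => 2 * j + α) a u * sinSeries (fun j => 2 * j + β) b u
      = ∑' p : ℤ × ℤ, a p.1 * b p.2 * cos ((2 * (p.1 + p.2) + (α + β)) * u) := by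
    simp only [cosSeries, sinSeries]
    rw [hc, hs, ← hsub]
    refine tsum_congr fun p => ?_
    rw [show (2 * ((p.1 : ℝ) + p.2) + (α + β)) * u
      = (2 * p.1 + α) * u + (2 * p.2 + β) * u by ring, cos_add]
    ring
  have key' := subShear.summable_iff.2 key
  rw [hcos, ← subShear.tsum_eq, cosSeries]
  refine (Summable.tsum_prod key').trans (tsum_congr fun n => ?_)
  rw [← tsum_mul_right]
  refine tsum_congr fun j => ?_
  simp [subShear]

/-! ### Telescoping sums of hyperbolic functions -/

lemma tendsto_tanh_atTop : Tendsto tanh atTop (𝓝 1) := by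
  have h : ∀ x : ℝ, tanh x = 1 - 2 / (exp (2 * x) + 1) := fun x => by
    rw [tanh_eq, exp_neg, two_mul, exp_add]
    have := exp_pos x
    field_simp
    ring
  have h2 : Tendsto (fun x : ℝ => 1 - 2 / (exp (2 * x) + 1)) atTop (𝓝 (1 - 0)) := by
    refine tendsto_const_nhds.sub (Tendsto.div_atTop tendsto_const_nhds ?_)
    refine tendsto_atTop_add_const_right _ _ (tendsto_exp_atTop.comp ?_)
    exact tendsto_id.const_mul_atTop (by norm_num)
  rw [sub_zero] at h2
  exact h2.congr fun x => (h x).symm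

lemma tanh_mul_tendsto {y : ℝ} (hy : 0 < y) (c : ℝ) :
    Tendsto (fun n : ℕ => tanh ((2 * (n : ℝ) + c) * y)) atTop (𝓝 1) := by
  refine tendsto_tanh_atTop.comp (Tendsto.atTop_mul_const hy ?_)
  exact tendsto_atTop_add_const_right _ _
    (tendsto_natCast_atTop_atTop.const_mul_atTop (by norm_num))

lemma tsum_tanh_sub {y : ℝ} (hy : 0 < y) (c : ℝ)
    (hs : Summable fun m : ℤ => tanh ((2 * m + 2 + c) * y) - tanh ((2 * m + c) * y)) :
    ∑' m : ℤ, (tanh ((2 * m + 2 + c) * y) - tanh ((2 * m + c) * y)) = 2 := by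
  have h1 := hs.hasSum.nat_add_neg_add_one.tendsto_sum_nat
  refine tendsto_nhds_unique h1 ?_
  let h : ℕ → ℝ := fun n => tanh ((2 * n + c) * y) - tanh ((2 * (-(n : ℝ)) + c) * y)
  have h2 : ∀ n : ℕ, ∑ i ∈ Finset.range n,
      ((tanh ((2 * ((i : ℤ) : ℝ) + 2 + c) * y) - tanh ((2 * ((i : ℤ) : ℝ) + c) * y))
        + (tanh ((2 * ((-((i : ℤ) + 1) : ℤ) : ℝ) + 2 + c) * y)
          - tanh ((2 * ((-((i : ℤ) + 1) : ℤ) : ℝ) + c) * y))) = h n - h 0 := fun n => by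
    rw [← Finset.sum_range_sub]
    refine Finset.sum_congr rfl fun i _ => ?_
    simp only [h]
    push_cast
    ring_nf
  simp only [h2]
  have h3 : Tendsto h atTop (𝓝 (1 - (-1))) := by
    refine (tanh_mul_tendsto hy c).sub ?_
    refine (tanh_mul_tendsto hy (-c)).neg.congr fun n => ?_
    rw [← tanh_neg]
    ring_nf
  have : h 0 = 0 := by simp [h]
  rw [this]
  norm_num at h3 ⊢
  exact h3

/-- The building block of the convolution sums, with `1 / sinh 0 = 0` at `m = 0`. -/
noncomputable def cothSubTanh (y : ℝ) (n m : ℤ) : ℝ :=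
  cosh (2 * m * y) / sinh (2 * m * y) - tanh ((2 * m - 2 * n - 1) * y)

lemma cosh_mul_inv_sinh_mul_inv_cosh {y : ℝ} (hy : 0 < y) (n : ℤ) {m : ℤ} (hm : m ≠ 0) :
    cosh ((2 * n + 1) * y) * (1 / sinh (2 * m * y)) * (1 / cosh ((2 * (n - m : ℤ) + 1) * y))
      = cothSubTanh y n m := by
  have hs : sinh (2 * m * y) ≠ 0 := by
    rw [sinh_ne_zero]
    have : (m : ℝ) ≠ 0 := by exact_mod_cast hm
    positivity
  have hc : cosh ((2 * (n - m : ℤ) + 1) * y) ≠ 0 := (cosh_pos _).ne'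
  have e1 : (2 * (m : ℝ) - 2 * n - 1) * y = -((2 * ((n - m : ℤ) : ℝ) + 1) * y) := by
    push_cast; ring
  have e2 : (2 * (n : ℝ) + 1) * y = 2 * m * y + (2 * ((n - m : ℤ) : ℝ) + 1) * y := by
    push_cast; ring
  rw [cothSubTanh, e1, tanh_neg, tanh_eq_sinh_div_cosh, e2, cosh_add]
  field_simp
  ring

lemma summable_pow_mul_cothSubTanh {y : ℝ} (hy : 0 < y) (n : ℤ) (k : ℕ) :
    Summable fun m : ℤ => (2 * (m : ℝ)) ^ k * cothSubTanh y n m := by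
  have h := (summable_pow_div_sinh hy k).mul_left (cosh ((2 * n + 1) * y))
  refine Summable.of_norm_bounded_eventually h ?_
  filter_upwards [(Set.finite_singleton (0 : ℤ)).compl_mem_cofinite] with m hm
  rw [← cosh_mul_inv_sinh_mul_inv_cosh hy n hm]
  have h1 : 1 / cosh ((2 * (n - m : ℤ) + 1) * y) ≤ 1 := by
    rw [div_le_one (cosh_pos _)]
    exact one_le_cosh _
  have h0 : 0 ≤ 1 / cosh ((2 * (n - m : ℤ) + 1) * y) := by
    have := cosh_pos ((2 * (n - m : ℤ) + 1) * y)
    positivity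
  have hc := cosh_pos ((2 * n + 1) * y)
  simp only [norm_mul, norm_eq_abs, abs_pow, abs_of_nonneg h0, abs_of_pos hc, abs_div, abs_one]
  calc _ = cosh ((2 * n + 1) * y) * (|2 * (m : ℝ)| ^ k / |sinh (2 * m * y)|)
      * (1 / cosh ((2 * (n - m : ℤ) + 1) * y)) := by rw [abs_mul]; ring
    _ ≤ _ := mul_le_of_le_one_right (by positivity) h1

lemma cothSubTanh_succ_sub (y : ℝ) (n m : ℤ) :
    cothSubTanh y (n + 1) m - cothSubTanh y n m
      = tanh ((2 * m + 2 + (-2 * n - 3)) * y) - tanh ((2 * m + (-2 * n - 3)) * y) := by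
  simp only [cothSubTanh]
  push_cast
  ring_nf

lemma tsum_cothSubTanh_succ {y : ℝ} (hy : 0 < y) (n : ℤ) :
    ∑' m, cothSubTanh y (n + 1) m = ∑' m, cothSubTanh y n m + 2 := by
  have h0 := summable_pow_mul_cothSubTanh hy n 0
  have h1 := summable_pow_mul_cothSubTanh hy (n + 1) 0
  simp only [pow_zero, one_mul] at h0 h1
  have h2 := h1.sub h0
  have h3 := Summable.tsum_sub h1 h0
  simp only [cothSubTanh_succ_sub] at h2 h3
  rw [tsum_tanh_sub hy _ h2] at h3
  linarith

lemma tsum_cothSubTanh {y : ℝ} (hy : 0 < y) (n : ℤ) :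
    ∑' m, cothSubTanh y n m = 2 * n + 1 := by
  have hneg : ∑' m, cothSubTanh y (-1) m = -∑' m, cothSubTanh y 0 m := by
    rw [← tsum_neg, ← (Equiv.neg ℤ).tsum_eq]
    refine tsum_congr fun m => ?_
    simp only [cothSubTanh, Equiv.neg_apply]
    rw [show (2 * ((-m : ℤ) : ℝ) - 2 * ((-1 : ℤ) : ℝ) - 1) * y
      = -((2 * (m : ℝ) - 2 * ((0 : ℤ) : ℝ) - 1) * y) by push_cast; ring, tanh_neg,
      show 2 * ((-m : ℤ) : ℝ) * y = -(2 * (m : ℝ) * y) by push_cast; ring, cosh_neg, sinh_neg]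
    ring
  have h0 := tsum_cothSubTanh_succ hy (-1)
  rw [hneg] at h0
  norm_num at h0
  induction n using Int.induction_on with
  | zero => simp; linarith
  | succ i hi => rw [tsum_cothSubTanh_succ hy, hi]; push_cast; ring
  | pred i hi =>
    have := tsum_cothSubTanh_succ hy (-(i : ℤ) - 1)
    rw [sub_add_cancel, hi] at this
    push_cast at this ⊢
    linarith

lemma tsum_mul_cothSubTanh_succ {y : ℝ} (hy : 0 < y) (n : ℤ) :
    ∑' m : ℤ, 2 * (m : ℝ) * cothSubTanh y (n + 1) m
      = ∑' m : ℤ, 2 * (m : ℝ) * cothSubTanh y n m + (4 * n + 4) := by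
  have h0 := summable_pow_mul_cothSubTanh hy n 0
  have h1 := summable_pow_mul_cothSubTanh hy (n + 1) 0
  have h0' := summable_pow_mul_cothSubTanh hy n 1
  have h1' := summable_pow_mul_cothSubTanh hy (n + 1) 1
  simp only [pow_zero, one_mul, pow_one] at h0 h1 h0' h1'
  have hd := h1.sub h0
  have hs : ∑' m : ℤ, (cothSubTanh y (n + 1) m - cothSubTanh y n m) = 2 := by
    rw [Summable.tsum_sub h1 h0, tsum_cothSubTanh hy, tsum_cothSubTanh hy]
    push_cast
    ring
  have hd' := h1'.sub h0'
  simp only [← mul_sub] at hd'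
  have hsub := Summable.tsum_sub h1' h0'
  simp only [← mul_sub] at hsub
  have hrefl : ∑' m : ℤ, 2 * (m : ℝ) * (cothSubTanh y (n + 1) m - cothSubTanh y n m)
      = ∑' m : ℤ, ((4 * n + 4) * (cothSubTanh y (n + 1) m - cothSubTanh y n m)
        - 2 * (m : ℝ) * (cothSubTanh y (n + 1) m - cothSubTanh y n m)) := by
    rw [← (Equiv.subLeft (2 * n + 2 : ℤ)).tsum_eq]
    refine tsum_congr fun m => ?_
    have : cothSubTanh y (n + 1) (2 * n + 2 - m) - cothSubTanh y n (2 * n + 2 - m)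
        = cothSubTanh y (n + 1) m - cothSubTanh y n m := by
      rw [cothSubTanh_succ_sub, cothSubTanh_succ_sub]
      push_cast
      rw [show (2 * (2 * (n : ℝ) + 2 - m) + 2 + (-2 * n - 3)) * y
        = -((2 * (m : ℝ) + (-2 * n - 3)) * y) by ring,
        show (2 * (2 * (n : ℝ) + 2 - m) + (-2 * n - 3)) * y
        = -((2 * (m : ℝ) + 2 + (-2 * n - 3)) * y) by ring, tanh_neg, tanh_neg]
      ring
    simp only [Equiv.subLeft_apply, this]
    push_cast
    ring
  rw [Summable.tsum_sub (hd.mul_left _) hd', tsum_mul_left, hs] at hrefl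
  linarith

lemma tsum_mul_cothSubTanh {y : ℝ} (hy : 0 < y) (n : ℤ) :
    ∑' m : ℤ, 2 * (m : ℝ) * cothSubTanh y n m
      = ((2 * n + 1) ^ 2 - 1) / 2 + ∑' m : ℤ, 2 * (m : ℝ) * cothSubTanh y 0 m := by
  induction n using Int.induction_on with
  | zero => simp
  | succ i hi => rw [tsum_mul_cothSubTanh_succ hy, hi]; push_cast; ring
  | pred i hi =>
    have := tsum_mul_cothSubTanh_succ hy (-(i : ℤ) - 1)
    rw [sub_add_cancel, hi] at this
    push_cast at this ⊢
    linarith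

/-! ### The elliptic differential equation -/

/-- The odd frequencies. -/
def oddFreq (j : ℤ) : ℝ := 2 * j + 1

/-- The even frequencies. -/
def evenFreq (m : ℤ) : ℝ := 2 * m

/-- Coefficients of the `sech` series. -/
noncomputable def sechCoeff (y : ℝ) (k : ℕ) (j : ℤ) : ℝ := oddFreq j ^ k / cosh (oddFreq j * y)

/-- Coefficients of the `sech * tanh` series. -/
noncomputable def sechTanhCoeff (y : ℝ) (k : ℕ) (j : ℤ) : ℝ :=
  oddFreq j ^ k * tanh (oddFreq j * y) / cosh (oddFreq j * y)

/-- Coefficients of the `1 / sinh` series. -/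
noncomputable def cschCoeff (y : ℝ) (k : ℕ) (m : ℤ) : ℝ := evenFreq m ^ k / sinh (evenFreq m * y)

lemma summable_sechCoeff {y : ℝ} (hy : 0 < y) (k : ℕ) : Summable (sechCoeff y k) := by
  refine Summable.of_norm_bounded (summable_pow_div_cosh hy k) fun j => ?_
  simp [sechCoeff, oddFreq, abs_of_pos (cosh_pos _)]

lemma abs_tanh_le_one (x : ℝ) : |tanh x| ≤ 1 := by
  rw [tanh_eq_sinh_div_cosh, abs_div, abs_of_pos (cosh_pos x), div_le_one (cosh_pos x),
    abs_sinh, ← cosh_abs]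
  exact (sinh_lt_cosh _).le

lemma summable_sechTanhCoeff {y : ℝ} (hy : 0 < y) (k : ℕ) : Summable (sechTanhCoeff y k) := by
  refine Summable.of_norm_bounded (summable_sechCoeff hy k).abs fun j => ?_
  have : sechTanhCoeff y k j = sechCoeff y k j * tanh (oddFreq j * y) := by
    simp only [sechTanhCoeff, sechCoeff]; ring
  rw [this, norm_mul, norm_eq_abs]
  exact mul_le_of_le_one_right (abs_nonneg _) (abs_tanh_le_one _)

lemma summable_cschCoeff {y : ℝ} (hy : 0 < y) (k : ℕ) : Summable (cschCoeff y k) := by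
  refine Summable.of_norm_bounded (summable_pow_div_sinh hy k) fun j => ?_
  simp [cschCoeff, evenFreq]

lemma oddFreq_mul_sechCoeff (y : ℝ) (k : ℕ) :
    (fun j => oddFreq j * sechCoeff y k j) = sechCoeff y (k + 1) := by
  funext j; simp only [sechCoeff]; ring

lemma oddFreq_mul_sechTanhCoeff (y : ℝ) (k : ℕ) :
    (fun j => oddFreq j * sechTanhCoeff y k j) = sechTanhCoeff y (k + 1) := by
  funext j; simp only [sechTanhCoeff]; ring

lemma evenFreq_mul_cschCoeff (y : ℝ) (k : ℕ) :
    (fun j => evenFreq j * cschCoeff y k j) = cschCoeff y (k + 1) := by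
  funext j; simp only [cschCoeff]; ring

lemma hasDerivAt_cosSeries_sechCoeff {y : ℝ} (hy : 0 < y) (k : ℕ) (u : ℝ) :
    HasDerivAt (cosSeries oddFreq (sechCoeff y k)) (-sinSeries oddFreq (sechCoeff y (k + 1)) u) u := by
  have := hasDerivAt_cosSeries (φ := oddFreq) (summable_sechCoeff hy k)
    (by rw [oddFreq_mul_sechCoeff]; exact summable_sechCoeff hy (k + 1)) u
  rwa [oddFreq_mul_sechCoeff] at this

lemma hasDerivAt_sinSeries_sechCoeff {y : ℝ} (hy : 0 < y) (k : ℕ) (u : ℝ) :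
    HasDerivAt (sinSeries oddFreq (sechCoeff y k)) (cosSeries oddFreq (sechCoeff y (k + 1)) u) u := by
  have := hasDerivAt_sinSeries (φ := oddFreq) (summable_sechCoeff hy k)
    (by rw [oddFreq_mul_sechCoeff]; exact summable_sechCoeff hy (k + 1)) u
  rwa [oddFreq_mul_sechCoeff] at this

lemma hasDerivAt_cosSeries_sechTanhCoeff {y : ℝ} (hy : 0 < y) (k : ℕ) (u : ℝ) :
    HasDerivAt (cosSeries oddFreq (sechTanhCoeff y k))
      (-sinSeries oddFreq (sechTanhCoeff y (k + 1)) u) u := by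
  have := hasDerivAt_cosSeries (φ := oddFreq) (summable_sechTanhCoeff hy k)
    (by rw [oddFreq_mul_sechTanhCoeff]; exact summable_sechTanhCoeff hy (k + 1)) u
  rwa [oddFreq_mul_sechTanhCoeff] at this

lemma hasDerivAt_sinSeries_sechTanhCoeff {y : ℝ} (hy : 0 < y) (k : ℕ) (u : ℝ) :
    HasDerivAt (sinSeries oddFreq (sechTanhCoeff y k))
      (cosSeries oddFreq (sechTanhCoeff y (k + 1)) u) u := by
  have := hasDerivAt_sinSeries (φ := oddFreq) (summable_sechTanhCoeff hy k)
    (by rw [oddFreq_mul_sechTanhCoeff]; exact summable_sechTanhCoeff hy (k + 1)) u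
  rwa [oddFreq_mul_sechTanhCoeff] at this

lemma hasDerivAt_sinSeries_cschCoeff {y : ℝ} (hy : 0 < y) (k : ℕ) (u : ℝ) :
    HasDerivAt (sinSeries evenFreq (cschCoeff y k))
      (cosSeries evenFreq (cschCoeff y (k + 1)) u) u := by
  have := hasDerivAt_sinSeries (φ := evenFreq) (summable_cschCoeff hy k)
    (by rw [evenFreq_mul_cschCoeff]; exact summable_cschCoeff hy (k + 1)) u
  rwa [evenFreq_mul_cschCoeff] at this

lemma oddFreq_oddNeg (j : ℤ) : oddFreq (oddNeg j) = -oddFreq j := oddNeg_cast j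

lemma evenFreq_neg (j : ℤ) : evenFreq (-j) = -evenFreq j := by simp [evenFreq]

lemma sinSeries_sechCoeff_zero (y u : ℝ) : sinSeries oddFreq (sechCoeff y 0) u = 0 :=
  tsum_eq_zero_of_odd oddNeg fun j => by
    simp only [sechCoeff, oddFreq_oddNeg, neg_mul, cosh_neg, sin_neg]; ring

lemma sinSeries_cschCoeff_one (y u : ℝ) : sinSeries evenFreq (cschCoeff y 1) u = 0 :=
  tsum_eq_zero_of_odd (Equiv.neg ℤ) fun j => by
    simp only [cschCoeff, Equiv.neg_apply, evenFreq_neg, neg_mul, sinh_neg, sin_neg]; ring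

lemma cosSeries_cschCoeff_zero (y u : ℝ) : cosSeries evenFreq (cschCoeff y 0) u = 0 :=
  tsum_eq_zero_of_odd (Equiv.neg ℤ) fun j => by
    simp only [cschCoeff, Equiv.neg_apply, evenFreq_neg, neg_mul, sinh_neg, cos_neg]; ring

lemma tsum_sechCoeff_mul_sechCoeff {y : ℝ} (hy : 0 < y) {n : ℤ} (hn : n ≠ 0) :
    ∑' j, sechCoeff y 0 j * sechCoeff y 0 (n - j - 1) = cschCoeff y 1 n := by
  have hs : sinh (evenFreq n * y) ≠ 0 := by
    rw [sinh_ne_zero, evenFreq]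
    have : (n : ℝ) ≠ 0 := by exact_mod_cast hn
    positivity
  have h1 := summable_pow_mul_cothSubTanh hy (n - 1) 0
  have h2 := summable_pow_mul_cothSubTanh hy (-1) 0
  simp only [pow_zero, one_mul] at h1 h2
  have h3 : ∀ j, sechCoeff y 0 j * sechCoeff y 0 (n - j - 1)
      = (sinh (evenFreq n * y))⁻¹ * (cothSubTanh y (n - 1) j - cothSubTanh y (-1) j) := fun j => by
    have hc1 := (cosh_pos (oddFreq j * y)).ne'
    have hc2 := (cosh_pos (oddFreq (n - j - 1) * y)).ne'
    have e1 : cothSubTanh y (n - 1) j - cothSubTanh y (-1) j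
        = tanh (oddFreq j * y) + tanh (oddFreq (n - j - 1) * y) := by
      simp only [cothSubTanh, oddFreq]
      rw [show (2 * (j : ℝ) - 2 * ((n - 1 : ℤ) : ℝ) - 1) * y
        = -((2 * ((n - j - 1 : ℤ) : ℝ) + 1) * y) by push_cast; ring, tanh_neg]
      push_cast
      ring_nf
    have e2 : evenFreq n * y = oddFreq j * y + oddFreq (n - j - 1) * y := by
      simp only [oddFreq, evenFreq]; push_cast; ring
    rw [e1, tanh_eq_sinh_div_cosh, tanh_eq_sinh_div_cosh, eq_inv_mul_iff_mul_eq₀ hs, e2, sinh_add,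
      sechCoeff, sechCoeff]
    field_simp
  rw [tsum_congr h3, tsum_mul_left, h1.tsum_sub h2, tsum_cothSubTanh hy, tsum_cothSubTanh hy,
    cschCoeff, evenFreq]
  push_cast
  field_simp
  ring

set_option maxHeartbeats 1000000 in
lemma cosSeries_sechCoeff_sq {y : ℝ} (hy : 0 < y) : ∃ p : ℝ, ∀ u,
    cosSeries oddFreq (sechCoeff y 0) u ^ 2 = p + cosSeries evenFreq (cschCoeff y 1) u := by
  have hb : Summable fun k : ℤ => sechCoeff y 0 (k - 1) :=
    (Equiv.subRight (1 : ℤ)).summable_iff.2 (summable_sechCoeff hy 0)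
  refine ⟨∑' j, sechCoeff y 0 j * sechCoeff y 0 (0 - j - 1), fun u => ?_⟩
  have h := cosSeries_mul_sub_sinSeries_mul (summable_sechCoeff hy 0) hb 1 (-1) u
  set p := ∑' j, sechCoeff y 0 j * sechCoeff y 0 (0 - j - 1) with hp
  have h1 : cosSeries (fun j => 2 * (j : ℝ) + -1) (fun k : ℤ => sechCoeff y 0 (k - 1)) u
      = cosSeries oddFreq (sechCoeff y 0) u := by
    simp only [cosSeries]
    rw [← (Equiv.subRight (1 : ℤ)).tsum_eq (fun j => sechCoeff y 0 j * cos (oddFreq j * u))]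
    refine tsum_congr fun j => ?_
    simp only [Equiv.subRight_apply, oddFreq]
    push_cast
    ring_nf
  have h2 : sinSeries (fun j => 2 * (j : ℝ) + 1) (sechCoeff y 0) u = 0 :=
    sinSeries_sechCoeff_zero y u
  rw [h1, h2, zero_mul, sub_zero] at h
  rw [sq]
  refine h.trans ?_
  have h3 : ∀ n : ℤ, (∑' j, sechCoeff y 0 j * sechCoeff y 0 (n - j - 1))
        * cos ((2 * (n : ℝ) + (1 + -1)) * u)
      = (if n = 0 then p else 0)
        + cschCoeff y 1 n * cos (evenFreq n * u) := fun n => by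
    split_ifs with hn
    · subst hn
      simp [cschCoeff, evenFreq, hp]
    · rw [tsum_sechCoeff_mul_sechCoeff hy hn, evenFreq]
      ring_nf
  have hw := (summable_mul_cos (summable_cschCoeff hy 1) fun n => evenFreq n * u).hasSum
  exact (tsum_congr h3).trans ((hasSum_ite_eq 0 p).add hw).tsum_eq

/-- The convolution identities for the `sech` series. -/
lemma cosSeries_sechCoeff_mul {y : ℝ} (hy : 0 < y) : ∃ r : ℝ, ∀ u,
    cosSeries evenFreq (cschCoeff y 1) u * cosSeries oddFreq (sechCoeff y 0) u
      = cosSeries oddFreq (sechCoeff y 2) u / 2 + r * cosSeries oddFreq (sechCoeff y 0) u ∧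
    cosSeries oddFreq (sechTanhCoeff y 1) u
      = cosSeries oddFreq (sechCoeff y 2) u / 2 - r * cosSeries oddFreq (sechCoeff y 0) u
        + sinSeries evenFreq (cschCoeff y 0) u * sinSeries oddFreq (sechCoeff y 1) u := by
  refine ⟨∑' m : ℤ, 2 * (m : ℝ) * cothSubTanh y 0 m - 1 / 2, fun u => ?_⟩
  set R := ∑' m : ℤ, 2 * (m : ℝ) * cothSubTanh y 0 m with hR
  have hE (n : ℤ) := summable_pow_mul_cothSubTanh hy n 0
  have hE' (n : ℤ) := summable_pow_mul_cothSubTanh hy n 1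
  simp only [pow_zero, one_mul, pow_one] at hE hE'
  have c1 (n : ℤ) : ∑' m, cschCoeff y 1 m * sechCoeff y 0 (n - m)
      = sechCoeff y 2 n / 2 + (R - 1 / 2) * sechCoeff y 0 n := by
    have h3 : ∀ m, cschCoeff y 1 m * sechCoeff y 0 (n - m)
        = (cosh (oddFreq n * y))⁻¹ * (2 * m * cothSubTanh y n m) := fun m => by
      rcases eq_or_ne m 0 with rfl | hm
      · simp [cschCoeff, evenFreq]
      · rw [← cosh_mul_inv_sinh_mul_inv_cosh hy n hm, cschCoeff, sechCoeff, oddFreq, evenFreq,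
          oddFreq]
        have := (cosh_pos ((2 * n + 1) * y)).ne'
        field_simp
    rw [tsum_congr h3, tsum_mul_left, tsum_mul_cothSubTanh hy, ← hR, sechCoeff, sechCoeff, oddFreq]
    ring
  have c2 (n : ℤ) : ∑' m, cschCoeff y 0 m * sechCoeff y 1 (n - m)
      = sechCoeff y 2 n / 2 - (R - 1 / 2) * sechCoeff y 0 n - sechTanhCoeff y 1 n := by
    have h3 : ∀ m, cschCoeff y 0 m * sechCoeff y 1 (n - m)
        = (cosh (oddFreq n * y))⁻¹ * ((oddFreq n * cothSubTanh y n m - 2 * m * cothSubTanh y n m)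
          - if m = 0 then oddFreq n * tanh (oddFreq n * y) else 0) := fun m => by
      have hc := (cosh_pos ((2 * n + 1) * y)).ne'
      split_ifs with hm
      · subst hm
        have : (2 * ((0 : ℤ) : ℝ) - 2 * n - 1) * y = -(oddFreq n * y) := by
          simp [oddFreq]; ring
        rw [cothSubTanh, this, tanh_neg]
        simp [cschCoeff, evenFreq]
      · rw [← cosh_mul_inv_sinh_mul_inv_cosh hy n hm, cschCoeff, sechCoeff, oddFreq, evenFreq,
          oddFreq]
        have := (cosh_pos ((2 * n + 1) * y)).ne'
        field_simp
        push_cast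
        ring
    rw [tsum_congr h3, tsum_mul_left, Summable.tsum_sub (((hE n).mul_left _).sub (hE' n))
      (hasSum_ite_eq _ _).summable, Summable.tsum_sub ((hE n).mul_left _) (hE' n), tsum_mul_left,
      tsum_ite_eq, tsum_cothSubTanh hy, tsum_mul_cothSubTanh hy, ← hR, sechCoeff, sechCoeff,
      sechTanhCoeff, oddFreq]
    ring
  have e0 : ∀ a, cosSeries (fun m => 2 * (m : ℝ) + 0) a u = cosSeries evenFreq a u := fun a => by
    simp only [add_zero]; rfl
  have e0' : ∀ a, sinSeries (fun m => 2 * (m : ℝ) + 0) a u = sinSeries evenFreq a u := fun a => by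
    simp only [add_zero]; rfl
  have e1 : ∀ a, cosSeries (fun m => 2 * (m : ℝ) + 1) a u = cosSeries oddFreq a u := fun a => rfl
  have e1' : ∀ a, sinSeries (fun m => 2 * (m : ℝ) + 1) a u = sinSeries oddFreq a u := fun a => rfl
  have s2 := summable_mul_cos (summable_sechCoeff hy 2) fun j => oddFreq j * u
  have s0 := summable_mul_cos (summable_sechCoeff hy 0) fun j => oddFreq j * u
  have st := summable_mul_cos (summable_sechTanhCoeff hy 1) fun j => oddFreq j * u
  constructor
  · have h := cosSeries_mul_sub_sinSeries_mul (summable_cschCoeff hy 1) (summable_sechCoeff hy 0)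
      0 1 u
    rw [e0, e0', e1, e1', sinSeries_cschCoeff_one, zero_mul, sub_zero, zero_add, e1] at h
    rw [h]
    simp only [c1, cosSeries]
    rw [← tsum_div_const, ← tsum_mul_left, ← (s2.div_const 2).tsum_add (s0.mul_left _)]
    exact tsum_congr fun j => by ring
  · have h := cosSeries_mul_sub_sinSeries_mul (summable_cschCoeff hy 0) (summable_sechCoeff hy 1)
      0 1 u
    rw [e0, e0', e1, e1', cosSeries_cschCoeff_zero, zero_mul, zero_sub, zero_add, e1] at h
    have h4 : cosSeries oddFreq (fun n => ∑' m, cschCoeff y 0 m * sechCoeff y 1 (n - m)) u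
        = cosSeries oddFreq (sechCoeff y 2) u / 2
          - (R - 1 / 2) * cosSeries oddFreq (sechCoeff y 0) u
          - cosSeries oddFreq (sechTanhCoeff y 1) u := by
      simp only [c2, cosSeries]
      rw [← tsum_div_const, ← tsum_mul_left, ← (s2.div_const 2).tsum_sub (s0.mul_left _),
        ← ((s2.div_const 2).sub (s0.mul_left _)).tsum_sub st]
      exact tsum_congr fun j => by ring
    linarith

lemma cosSeries_oddFreq_half_pi (a : ℤ → ℝ) : cosSeries oddFreq a (π / 2) = 0 := by
  have : ∀ j : ℤ, a j * cos (oddFreq j * (π / 2)) = 0 := fun j => by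
    rw [oddFreq, show (2 * (j : ℝ) + 1) * (π / 2) = π / 2 + j * π by ring, cos_add_int_mul_pi]
    simp
  simp [cosSeries, this]

lemma sinSeries_evenFreq_half_pi (a : ℤ → ℝ) : sinSeries evenFreq a (π / 2) = 0 := by
  have : ∀ j : ℤ, a j * sin (evenFreq j * (π / 2)) = 0 := fun j => by
    rw [evenFreq, show 2 * (j : ℝ) * (π / 2) = j * π by ring, sin_int_mul_pi, mul_zero]
  simp [sinSeries, this]

/-- In the lemniscatic case, detected by the vanishing of the cubic series, the other series are
polynomials in the linear one. -/
lemma lemniscatic_identities {y : ℝ} (hy : 0 < y)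
    (h3 : sinSeries oddFreq (sechCoeff y 3) (π / 2) = 0)
    (h1 : sinSeries oddFreq (sechCoeff y 1) (π / 2) ≠ 0) :
    sinSeries oddFreq (sechCoeff y 5) (π / 2)
      = -12 * sinSeries oddFreq (sechCoeff y 1) (π / 2) ^ 3 ∧
    sinSeries oddFreq (sechTanhCoeff y 4) (π / 2)
      = -4 * sinSeries oddFreq (sechCoeff y 1) (π / 2) ^ 3 ∧
    ∀ u, sinSeries oddFreq (sechCoeff y 1) u ^ 2
      = cosSeries oddFreq (sechCoeff y 0) 0 ^ 4 - cosSeries oddFreq (sechCoeff y 0) u ^ 4 := by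
  obtain ⟨p, hp⟩ := cosSeries_sechCoeff_sq hy
  obtain ⟨r, hr⟩ := cosSeries_sechCoeff_mul hy
  set c := cosSeries oddFreq (sechCoeff y 0) with hc
  set s := sinSeries oddFreq (sechCoeff y 1) with hs
  set z := sinSeries evenFreq (cschCoeff y 0) with hz
  have dc : ∀ u, HasDerivAt c (-s u) u := hasDerivAt_cosSeries_sechCoeff hy 0
  have hc2 : ∀ u, cosSeries oddFreq (sechCoeff y 2) u = 2 * c u ^ 3 - 2 * (p + r) * c u := by
    intro u
    have e1 := (hr u).1
    have e2 := hp u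
    have e3 : cosSeries evenFreq (cschCoeff y 1) u = c u ^ 2 - p := by linarith
    rw [e3] at e1
    linarith
  have ds : ∀ u, HasDerivAt s (2 * c u ^ 3 - 2 * (p + r) * c u) u := fun u => by
    rw [← hc2]; exact hasDerivAt_sinSeries_sechCoeff hy 1 u
  have dz : ∀ u, HasDerivAt z (c u ^ 2 - p) u := fun u => by
    have := hasDerivAt_sinSeries_cschCoeff hy 0 u
    rwa [show cosSeries evenFreq (cschCoeff y (0 + 1)) u = c u ^ 2 - p by
      have := hp u; simp only [zero_add]; linarith] at this
  have c0 : c (π / 2) = 0 := cosSeries_oddFreq_half_pi _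
  have z0 : z (π / 2) = 0 := sinSeries_evenFreq_half_pi _
  have hs3 : ∀ u, sinSeries oddFreq (sechCoeff y 3) u = (6 * c u ^ 2 - 2 * (p + r)) * s u := by
    intro u
    have d1 := hasDerivAt_cosSeries_sechCoeff hy 2 u
    rw [funext hc2] at d1
    have d2 := (((dc u).pow 3).const_mul 2).sub ((dc u).const_mul (2 * (p + r)))
    have := d1.unique d2
    norm_num at this
    linarith
  have hpr : p + r = 0 := by
    have := hs3 (π / 2)
    rw [h3, c0] at this
    have := (mul_eq_zero.1 this.symm).resolve_right h1
    linarith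
  simp only [hpr, mul_zero, zero_mul, sub_zero] at hc2 ds hs3
  have hc4 : ∀ u, cosSeries oddFreq (sechCoeff y 4) u = 12 * c u ^ 5 - 12 * c u * s u ^ 2 := by
    intro u
    have d1 := hasDerivAt_sinSeries_sechCoeff hy 3 u
    rw [funext hs3] at d1
    have d2 := (((dc u).pow 2).const_mul 6).mul (ds u)
    have := d1.unique d2
    norm_num at this
    rw [this]
    ring
  have hD : ∀ u, cosSeries oddFreq (sechTanhCoeff y 1) u = c u ^ 3 + p * c u + z u * s u := by
    intro u
    rw [(hr u).2, hc2, show r = -p by linarith]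
    ring
  have hD2 : ∀ u, sinSeries oddFreq (sechTanhCoeff y 2) u
      = 2 * c u ^ 2 * s u + 2 * p * s u - 2 * z u * c u ^ 3 := by
    intro u
    have d1 := hasDerivAt_cosSeries_sechTanhCoeff hy 1 u
    rw [funext hD] at d1
    have d2 := (((dc u).pow 3).add ((dc u).const_mul p)).add ((dz u).mul (ds u))
    have := d1.unique d2
    norm_num at this
    linarith
  have hD3 : ∀ u, cosSeries oddFreq (sechTanhCoeff y 3) u
      = -4 * c u * s u ^ 2 + 2 * c u ^ 5 + 6 * p * c u ^ 3 + 6 * z u * c u ^ 2 * s u := by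
    intro u
    have d1 := hasDerivAt_sinSeries_sechTanhCoeff hy 2 u
    rw [funext hD2] at d1
    have d2 := (((((dc u).pow 2).const_mul 2).mul (ds u)).add ((ds u).const_mul (2 * p))).sub
      (((dz u).const_mul 2).mul ((dc u).pow 3))
    have := d1.unique d2
    norm_num at this
    rw [this]
    ring
  refine ⟨?_, ?_, fun u => ?_⟩
  · have d1 := hasDerivAt_cosSeries_sechCoeff hy 4 (π / 2)
    rw [funext hc4] at d1
    have d2 := (((dc (π / 2)).pow 5).const_mul 12).sub
      (((dc (π / 2)).const_mul 12).mul ((ds (π / 2)).pow 2))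
    have := d1.unique d2
    norm_num [c0] at this
    linarith
  · have d1 := hasDerivAt_cosSeries_sechTanhCoeff hy 3 (π / 2)
    rw [funext hD3] at d1
    have d2 := (((((dc (π / 2)).const_mul (-4)).mul ((ds (π / 2)).pow 2)).add
      (((dc (π / 2)).pow 5).const_mul 2)).add (((dc (π / 2)).pow 3).const_mul (6 * p))).add
      ((((dz (π / 2)).const_mul 6).mul ((dc (π / 2)).pow 2)).mul (ds (π / 2)))
    have := d1.unique d2
    norm_num [c0, z0] at this
    linarith
  · have hd : ∀ u, HasDerivAt (fun u => s u ^ 2 + c u ^ 4) 0 u := fun u => by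
      refine (((ds u).pow 2).add ((dc u).pow 4)).congr_deriv ?_
      norm_num
      ring
    have h0 : s 0 = 0 := by simp [hs, sinSeries]
    have := is_const_of_deriv_eq_zero (fun u => (hd u).differentiableAt) (fun u => (hd u).deriv) u 0
    simp only [h0] at this
    linarith

/-! ### The lemniscate integral -/

open Set MeasureTheory in
lemma four_mul_amplitude_mul_quarter_period {c s : ℝ → ℝ} {b : ℝ} (hb : 0 < b)
    (dc : ∀ u, HasDerivAt c (-s u) u) (hs : ∀ u ∈ Ioo 0 b, 0 < s u)
    (hE : ∀ u, s u ^ 2 = c 0 ^ 4 - c u ^ 4) (cb : c b = 0) :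
    0 < c 0 ∧ 4 * c 0 * b = ProbabilityTheory.beta (1 / 4) (1 / 2) := by
  have hcont : Continuous c := continuous_iff_continuousAt.2 fun u => (dc u).continuousAt
  have hanti : StrictAntiOn c (Icc 0 b) := by
    refine strictAntiOn_of_deriv_neg (convex_Icc _ _) hcont.continuousOn fun u hu => ?_
    rw [interior_Icc] at hu
    rw [(dc u).deriv]
    linarith [hs u hu]
  have hA : 0 < c 0 := by
    have := hanti (left_mem_Icc.2 hb.le) (right_mem_Icc.2 hb.le) hb
    rwa [cb] at this
  refine ⟨hA, ?_⟩
  set A := c 0 with hAdef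
  have hpos : ∀ u ∈ Icc 0 b, 0 ≤ c u := fun u hu => by
    rw [← cb]
    exact hanti.antitoneOn hu (right_mem_Icc.2 hb.le) hu.2
  have hpos' : ∀ u ∈ Ioo 0 b, 0 < c u := fun u hu => by
    rw [← cb]
    exact hanti (Ioo_subset_Icc_self hu) (right_mem_Icc.2 hb.le) hu.2
  let g : ℝ → ℝ := fun u => (c u / A) ^ 4
  have hg : StrictAntiOn g (Icc 0 b) := fun u hu v hv huv => by
    have h1 := hpos v hv
    have h2 := hanti hu hv huv
    simp only [g]
    gcongr
  have hgc : Continuous g := (hcont.div_const A).pow 4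
  have himg : g '' Ioo 0 b = Ioo 0 1 := by
    rw [hgc.continuousOn.image_Ioo_of_strictAntiOn hb.le hg]
    simp [g, cb, ← hAdef, hA.ne']
  have dg : ∀ u, HasDerivAt g (4 * (c u / A) ^ 3 * (-s u / A)) u := fun u => by
    refine (((dc u).div_const A).pow 4).congr_deriv ?_
    norm_num
  have hcv := integral_image_eq_integral_abs_deriv_smul (measurableSet_Ioo (a := 0) (b := b))
    (fun u _ => (dg u).hasDerivWithinAt) (hg.injOn.mono Ioo_subset_Icc_self)
    (fun x : ℝ => x ^ ((1 : ℝ) / 4 - 1) * (1 - x) ^ ((1 : ℝ) / 2 - 1))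
  rw [himg] at hcv
  have hconst : ∀ u ∈ Ioo 0 b, |4 * (c u / A) ^ 3 * (-s u / A)| •
      (g u ^ ((1 : ℝ) / 4 - 1) * (1 - g u) ^ ((1 : ℝ) / 2 - 1)) = 4 * A := fun u hu => by
    have hc := hpos' u hu
    have hsu := hs u hu
    have e1 : g u ^ ((1 : ℝ) / 4 - 1) = ((c u / A) ^ 3)⁻¹ := by
      simp only [g]
      rw [← rpow_natCast, ← rpow_natCast, ← rpow_mul (by positivity), ← rpow_neg (by positivity)]
      norm_num
    have e2 : 1 - g u = (s u / A ^ 2) ^ 2 := by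
      simp only [g]
      rw [div_pow, div_pow, hE]
      field_simp
    have e3 : (1 - g u) ^ ((1 : ℝ) / 2 - 1) = (s u / A ^ 2)⁻¹ := by
      rw [e2, ← rpow_natCast, ← rpow_mul (by positivity), ← rpow_neg_one]
      norm_num
    rw [e1, e3, abs_mul, abs_of_pos (by positivity : 0 < 4 * (c u / A) ^ 3), neg_div, abs_neg,
      abs_of_pos (by positivity : 0 < s u / A), smul_eq_mul]
    field_simp
  rw [setIntegral_congr_fun measurableSet_Ioo hconst, setIntegral_const] at hcv
  have hvol : volume.real (Ioo 0 b) = b := by simp [hb.le]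
  rw [hvol, smul_eq_mul] at hcv
  rw [ProbabilityTheory.beta_eq_betaIntegralReal _ _ (by norm_num) (by norm_num),
    Complex.betaIntegral, intervalIntegral.integral_of_le zero_le_one,
    integral_Ioc_eq_integral_Ioo]
  have hcx : ∀ x ∈ Ioo (0 : ℝ) 1, (x : ℂ) ^ (((1 / 4 : ℝ) : ℂ) - 1) * (1 - (x : ℂ)) ^ (((1 / 2 : ℝ) : ℂ) - 1)
      = ((x ^ ((1 : ℝ) / 4 - 1) * (1 - x) ^ ((1 : ℝ) / 2 - 1) : ℝ) : ℂ) := fun x hx => by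
    rw [Complex.ofReal_mul, Complex.ofReal_cpow hx.1.le, Complex.ofReal_cpow (by linarith [hx.2])]
    push_cast
    rfl
  rw [setIntegral_congr_fun measurableSet_Ioo hcx, integral_complex_ofReal, Complex.ofReal_re,
    hcv]
  ring

lemma beta_quarter_half_sq :
    ProbabilityTheory.beta (1 / 4) (1 / 2) ^ 2 = Gamma (1 / 4) ^ 4 / (2 * π) := by
  have h := Gamma_mul_Gamma_one_sub (1 / 4)
  rw [show π * (1 / 4) = π / 4 by ring, sin_pi_div_four, show (1 : ℝ) - 1 / 4 = 3 / 4 by norm_num] at h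
  have hG : Gamma (1 / 4) ≠ 0 := (Gamma_pos_of_pos (by norm_num)).ne'
  have hG' : Gamma (3 / 4) ≠ 0 := (Gamma_pos_of_pos (by norm_num)).ne'
  have h34 : Gamma (3 / 4) = π / (√2 / 2) / Gamma (1 / 4) := by
    rw [← h]
    field_simp
  have hpi := pi_pos.ne'
  have h2 : (√2) ^ 2 = 2 := sq_sqrt (by norm_num)
  have h2' : √2 ≠ 0 := by positivity
  rw [ProbabilityTheory.beta, show (1 / 4 : ℝ) + 1 / 2 = 3 / 4 by norm_num, Gamma_one_half_eq,
    div_pow, mul_pow, sq_sqrt pi_pos.le, h34]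
  field_simp
  rw [h2]

/-! ### Values at the lemniscatic point -/

lemma tsum_int_eq_two_mul {𝕜 : Type*} [NormedField 𝕜] [CompleteSpace 𝕜] {f : ℤ → 𝕜}
    (hf : Summable f) (h : ∀ j, f (oddNeg j) = f j) :
    ∑' j, f j = 2 * ∑' n : ℕ, f n := by
  have h1 : ∀ n : ℕ, f (-((n : ℤ) + 1)) = f n := fun n => by
    rw [← h n, oddNeg, Equiv.subLeft_apply]
    congr 1
    ring
  have h2 : Summable fun n : ℕ => f n := hf.comp_injective Nat.cast_injective
  rw [tsum_of_nat_of_neg_add_one h2 (by simpa only [h1] using h2)]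
  simp only [h1]
  ring

lemma abs_sin_nat_mul_le (n : ℕ) (x : ℝ) : |sin (n * x)| ≤ n * |sin x| := by
  induction n with
  | zero => simp
  | succ n ih =>
    push_cast
    rw [add_mul, one_mul, sin_add]
    calc _ ≤ |sin (n * x)| * |cos x| + |cos (n * x)| * |sin x| := by
          rw [← abs_mul, ← abs_mul]; exact abs_add_le _ _
      _ ≤ |sin (n * x)| * 1 + 1 * |sin x| := by
          gcongr
          · exact abs_cos_le_one _
          · exact abs_cos_le_one _
      _ ≤ _ := by linarith

lemma cosh_odd_mul_half_pi_ge (n : ℕ) :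
    18 ^ n * cosh (π / 2) ≤ cosh ((2 * (n : ℝ) + 1) * (π / 2)) := by
  have hpi : 10 ≤ cosh π := by
    have h1 : exp 3 ≤ exp π := exp_le_exp.2 pi_gt_three.le
    have h2 : exp 3 = exp 1 ^ 3 := by rw [← exp_nat_mul]; norm_num
    have h3 : (2.7182818283 : ℝ) ^ 3 ≤ exp 1 ^ 3 := by
      gcongr
      exact exp_one_gt_d9.le
    rw [cosh_eq]
    have := exp_pos (-π)
    norm_num at h3
    linarith
  induction n with
  | zero => simp
  | succ n ih =>
    have e1 : cosh ((2 * (n : ℝ) + 1) * (π / 2) + π) + cosh ((2 * (n : ℝ) + 1) * (π / 2) - π)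
        = 2 * cosh π * cosh ((2 * (n : ℝ) + 1) * (π / 2)) := by
      rw [cosh_add, cosh_sub]; ring
    have e2 : cosh ((2 * (n : ℝ) + 1) * (π / 2) - π) ≤ cosh ((2 * (n : ℝ) + 1) * (π / 2)) := by
      have hn := mul_nonneg (Nat.cast_nonneg (α := ℝ) n) pi_pos.le
      have hp : 0 ≤ (2 * (n : ℝ) + 1) * (π / 2) := by positivity
      rw [cosh_le_cosh, abs_of_nonneg hp, abs_le]
      constructor <;> linarith [pi_pos]
    have e3 : (2 * ((n + 1 : ℕ) : ℝ) + 1) * (π / 2) = (2 * (n : ℝ) + 1) * (π / 2) + π := by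
      push_cast; ring
    have := cosh_pos ((2 * (n : ℝ) + 1) * (π / 2))
    rw [e3, pow_succ]
    nlinarith

lemma sinSeries_sechCoeff_one_pos {u : ℝ} (hu : 0 < sin u) :
    0 < sinSeries oddFreq (sechCoeff (π / 2) 1) u := by
  have hs := summable_mul_sin (summable_sechCoeff (half_pos pi_pos) 1) fun j => oddFreq j * u
  rw [sinSeries, tsum_int_eq_two_mul hs fun j => by
    simp only [sechCoeff, oddFreq_oddNeg, neg_mul, cosh_neg, sin_neg]; ring]
  have hs' : Summable fun n : ℕ => sechCoeff (π / 2) 1 n * sin (oddFreq n * u) :=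
    hs.comp_injective Nat.cast_injective
  rw [hs'.tsum_eq_zero_add]
  have hC := cosh_pos (π / 2)
  set B := sin u / cosh (π / 2) with hB
  have hBpos : 0 < B := by positivity
  have h0 : sechCoeff (π / 2) 1 ((0 : ℕ) : ℤ) * sin (oddFreq ((0 : ℕ) : ℤ) * u) = B := by
    simp [sechCoeff, oddFreq, hB]; ring
  have hgeo : HasSum (fun n : ℕ => B * (1 / 2) * (1 / 6 : ℝ) ^ n) (B * (1 / 2) * (1 - 1 / 6)⁻¹) :=
    (hasSum_geometric_of_lt_one (by norm_num) (by norm_num)).mul_left _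
  have hbd : ∀ n : ℕ, |sechCoeff (π / 2) 1 ((n + 1 : ℕ) : ℤ) * sin (oddFreq ((n + 1 : ℕ) : ℤ) * u)|
      ≤ B * (1 / 2) * (1 / 6 : ℝ) ^ n := fun n => by
    have h1 := abs_sin_nat_mul_le (2 * (n + 1) + 1) u
    have h2 := cosh_odd_mul_half_pi_ge (n + 1)
    have h3 : ((2 : ℝ) * (n + 1) + 1) ^ 2 ≤ 9 * 3 ^ n := by
      clear h1 h2
      induction n with
      | zero => norm_num
      | succ n ih => push_cast; rw [pow_succ (3 : ℝ)]; nlinarith [Nat.cast_nonneg (α := ℝ) n]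
    rw [abs_of_pos hu] at h1
    push_cast at h1 h2
    have h4 : (0 : ℝ) < 2 * (n + 1) + 1 := by positivity
    simp only [sechCoeff, oddFreq, pow_one, abs_mul, abs_div]
    push_cast
    rw [abs_of_pos h4, abs_of_pos (cosh_pos _)]
    calc _ ≤ (2 * ((n : ℝ) + 1) + 1) / (18 ^ (n + 1) * cosh (π / 2))
        * ((2 * ((n : ℝ) + 1) + 1) * sin u) := by gcongr
      _ = (2 * ((n : ℝ) + 1) + 1) ^ 2 * (B / 18 ^ (n + 1)) := by rw [hB]; field_simp
      _ ≤ 9 * 3 ^ n * (B / 18 ^ (n + 1)) := by gcongr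
      _ = _ := by
        rw [pow_succ, show (18 : ℝ) = 3 * 6 by norm_num, mul_pow, div_pow, one_pow]
        field_simp
        norm_num
  have := tsum_of_norm_bounded (f := fun n : ℕ => sechCoeff (π / 2) 1 ((n + 1 : ℕ) : ℤ) *
    sin (oddFreq ((n + 1 : ℕ) : ℤ) * u)) hgeo hbd
  rw [norm_eq_abs] at this
  have := (abs_le.1 this).1
  rw [h0]
  norm_num at this ⊢
  linarith

lemma sinSeries_sechCoeff_one_half_pi
    (h3 : sinSeries oddFreq (sechCoeff (π / 2) 3) (π / 2) = 0) :
    sinSeries oddFreq (sechCoeff (π / 2) 1) (π / 2) = Gamma (1 / 4) ^ 4 / (8 * π ^ 3) := by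
  have hy := half_pos pi_pos
  have hpos : 0 < sinSeries oddFreq (sechCoeff (π / 2) 1) (π / 2) :=
    sinSeries_sechCoeff_one_pos (by simp)
  obtain ⟨-, -, hE⟩ := lemniscatic_identities hy h3 hpos.ne'
  obtain ⟨hA, h⟩ := four_mul_amplitude_mul_quarter_period hy (hasDerivAt_cosSeries_sechCoeff hy 0)
    (fun u hu => sinSeries_sechCoeff_one_pos (sin_pos_of_pos_of_lt_pi hu.1 (by linarith [hu.2])))
    hE (cosSeries_oddFreq_half_pi _)
  have hb := beta_quarter_half_sq
  have hEb := hE (π / 2)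
  rw [cosSeries_oddFreq_half_pi] at hEb
  set A := cosSeries oddFreq (sechCoeff (π / 2) 0) 0
  have h5 : sinSeries oddFreq (sechCoeff (π / 2) 1) (π / 2) = A ^ 2 := by
    rw [← sq_eq_sq₀ hpos.le (by positivity), hEb]
    ring
  rw [h5, eq_div_iff (by positivity)]
  rw [← h, eq_div_iff (by positivity)] at hb
  rw [← hb]
  ring

/-! ### A weight-four Eisenstein series with character -/

lemma hasSum_int_even_add_odd {M : Type*} [AddCommMonoid M] [TopologicalSpace M]
    [ContinuousAdd M] {f : ℤ → M} {a b : M} (he : HasSum (fun k => f (2 * k)) a)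
    (ho : HasSum (fun k => f (2 * k + 1)) b) : HasSum f (a + b) := by
  have hinj := mul_right_injective₀ (two_ne_zero' ℤ)
  replace ho := ((add_left_injective 1).comp hinj).hasSum_range_iff.2 ho
  exact (hinj.hasSum_range_iff.2 he).add_isCompl
    (by simpa [Function.comp_def] using Int.isCompl_even_odd) ho

/-- The nontrivial character mod 4 at the odd integer `2 j + 1`. -/
noncomputable def oddSign (j : ℤ) : ℝ := sin (oddFreq j * (π / 2))

lemma oddSign_two_mul (k : ℤ) : oddSign (2 * k) = 1 := by
  have e : oddFreq (2 * k) * (π / 2) = π / 2 + k * (2 * π) := by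
    rw [oddFreq]
    push_cast
    ring
  rw [oddSign, e, sin_add_int_mul_two_pi, sin_pi_div_two]

lemma oddSign_two_mul_add_one (k : ℤ) : oddSign (2 * k + 1) = -1 := by
  have e : oddFreq (2 * k + 1) * (π / 2) = π / 2 + π + k * (2 * π) := by
    rw [oddFreq]
    push_cast
    ring
  rw [oddSign, e, sin_add_int_mul_two_pi, sin_add_pi, sin_pi_div_two]

lemma oddSign_oddNeg (j : ℤ) : oddSign (oddNeg j) = -oddSign j := by
  rw [oddSign, oddFreq_oddNeg, neg_mul, sin_neg, oddSign]

lemma abs_oddSign_le_one (j : ℤ) : |oddSign j| ≤ 1 := abs_sin_le_one _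

lemma oddSign_natCast (n : ℕ) : oddSign n = (-1) ^ n := by
  rw [oddSign, oddFreq, show (2 * ((n : ℤ) : ℝ) + 1) * (π / 2) = π / 2 + n * π by push_cast; ring,
    sin_add_nat_mul_pi, sin_pi_div_two, mul_one]

/-- The summand of the weight-four Eisenstein series with character mod 4. -/
noncomputable def oddEisSummand (t : ℝ) (j m : ℤ) : ℂ :=
  oddSign j * oddSign m / ((oddFreq m : ℂ) + Complex.I * (t * oddFreq j)) ^ 4

lemma summable_oddEisSummand {t : ℝ} (ht : 0 < t) :
    Summable fun p : ℤ × ℤ => oddEisSummand t p.1 p.2 := by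
  let z : UpperHalfPlane := ⟨Complex.I * t, by simpa using ht⟩
  have h := summable_prod_eisSummand (k := 4) (by norm_num) z
  have hinj : Function.Injective fun p : ℤ × ℤ => (2 * p.1 + 1, 2 * p.2 + 1) := fun p q h => by
    simp only [Prod.mk.injEq] at h
    ext <;> omega
  refine Summable.of_norm_bounded (h.comp_injective hinj).norm fun p => ?_
  simp only [Function.comp, EisensteinSeries.eisSummand, oddEisSummand]
  have e : (oddFreq p.2 : ℂ) + Complex.I * (t * oddFreq p.1)
      = ((2 * p.1 + 1 : ℤ) : ℂ) * (z : ℂ) + ((2 * p.2 + 1 : ℤ) : ℂ) := by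
    simp only [oddFreq, z]
    push_cast
    ring
  rw [e, div_eq_mul_inv, norm_mul, norm_mul, Complex.norm_real, Complex.norm_real]
  refine (mul_le_of_le_one_left (norm_nonneg _) (mul_le_one₀ (abs_oddSign_le_one _)
    (norm_nonneg _) (abs_oddSign_le_one _))).trans_eq ?_
  simp [zpow_neg]

/-- The weight-four Eisenstein series with character mod 4 on the imaginary axis. -/
noncomputable def oddEis (t : ℝ) : ℂ := ∑' (j : ℤ) (m : ℤ), oddEisSummand t j m

lemma oddEis_inv {t : ℝ} (ht : 0 < t) : oddEis (1 / t) = -(t : ℂ) ^ 4 * oddEis t := by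
  have hs := summable_oddEisSummand ht
  have key : ∀ j m, oddEisSummand (1 / t) j m = -(t : ℂ) ^ 4 * oddEisSummand t (oddNeg m) j := by
    intro j m
    have ht' : (t : ℂ) ≠ 0 := by exact_mod_cast ht.ne'
    simp only [oddEisSummand, oddSign_oddNeg, oddFreq_oddNeg]
    have e : ((oddFreq m : ℂ) + Complex.I * ((1 / t : ℝ) * oddFreq j))
        = Complex.I / t * (oddFreq j + Complex.I * (t * (-oddFreq m : ℝ))) := by
      push_cast
      field_simp
      linear_combination ((oddFreq m : ℂ) * t) * Complex.I_sq
    rw [e, mul_pow, div_pow, Complex.I_pow_four]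
    push_cast
    field_simp
  have hs' : Summable (Function.uncurry fun m j => oddEisSummand t m j) := hs
  simp only [oddEis, key, tsum_mul_left]
  congr 1
  simp only [fun x => oddNeg.tsum_eq fun y => oddEisSummand t y x]
  exact hs'.tsum_comm

open Complex in
lemma hasSum_one_div_shift_pow_four {x : ℝ} (hx : 0 < x) (a : ℝ) :
    HasSum (fun n : ℤ => 1 / (4 * (n : ℂ) + a + I * x) ^ 4) (π ^ 4 / 96 *
      ∑' n : ℕ, (n : ℂ) ^ 3 * rexp (-(n * (π / 2 * x))) * cexp (a * (π / 2 * I)) ^ n) := by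
  let z : UpperHalfPlane := ⟨(I * x + a) / 4, by simpa using hx⟩
  have hz : (z : ℂ) = (I * x + a) / 4 := rfl
  have hsum : Summable fun n : ℤ => 1 / ((z : ℂ) + n) ^ (3 + 1) := by
    simpa using EisensteinSeries.linear_right_summable (z : ℂ) 1 (k := 4) (by norm_num)
  have hq : ∀ n : ℕ, (n : ℂ) ^ 3 * cexp (2 * π * I * z) ^ n
      = (n : ℂ) ^ 3 * rexp (-(n * (π / 2 * x))) * cexp (a * (π / 2 * I)) ^ n := fun n => by
    rw [mul_assoc ((n : ℂ) ^ 3), ← Complex.exp_nat_mul, ← Complex.exp_nat_mul, ofReal_exp, ← Complex.exp_add, hz]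
    congr 2
    push_cast
    linear_combination (n * π * x / 2 : ℂ) * I_sq
  have hL := EisensteinSeries.qExpansion_identity (k := 3) (by norm_num) z
  simp only [hq] at hL
  have hc : (-2 * π * I) ^ (3 + 1) / (Nat.factorial 3 : ℂ) = 256 * (π ^ 4 / 96) := by
    rw [show (-2 * π * I : ℂ) ^ (3 + 1) = 16 * π ^ 4 * I ^ 4 by ring, I_pow_four]
    norm_num [Nat.factorial]
    ring
  rw [hc] at hL
  have h := hsum.hasSum.mul_left (1 / 256)
  rw [hL, ← mul_assoc, ← mul_assoc, one_div_mul_cancel (by norm_num), one_mul] at h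
  refine h.congr_fun fun n => ?_
  have e : 4 * (n : ℂ) + a + I * x = 4 * ((z : ℂ) + n) := by rw [hz]; ring
  rw [e, mul_pow]
  field_simp
  norm_num

lemma tsum_nat_even_add_odd {f : ℕ → ℂ} (hf : Summable f) :
    ∑' d, f (2 * d) + ∑' d, f (2 * d + 1) = ∑' n, f n :=
  tsum_even_add_odd
    (hf.comp_injective (i := fun n : ℕ => 2 * n) fun a b h => by simpa using h)
    (hf.comp_injective (i := fun n : ℕ => 2 * n + 1) fun a b h => by simpa using h)

open Complex in
lemma tsum_mul_I_pow_sub {f : ℕ → ℂ} (hf : Summable fun n => ‖f n‖) :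
    ∑' n, f n * I ^ n - ∑' n, f n * (-I) ^ n
      = 2 * I * ∑' d : ℕ, (oddSign d : ℂ) * f (2 * d + 1) := by
  have hsum : ∀ w : ℂ, ‖w‖ = 1 → Summable fun n => f n * w ^ n := fun w hw =>
    Summable.of_norm (hf.congr fun n => by rw [norm_mul, norm_pow, hw, one_pow, mul_one])
  have hI := hsum I norm_I
  have hI' := hsum (-I) (by rw [norm_neg, norm_I])
  have hS := hI.sub hI'
  have h := tsum_nat_even_add_odd hS
  have e0 : ∀ d : ℕ, f (2 * d) * I ^ (2 * d) - f (2 * d) * (-I) ^ (2 * d) = 0 := fun d => by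
    rw [pow_mul, pow_mul, neg_sq, sub_self]
  have e1 : ∀ d : ℕ, f (2 * d + 1) * I ^ (2 * d + 1) - f (2 * d + 1) * (-I) ^ (2 * d + 1)
      = 2 * I * ((oddSign d : ℂ) * f (2 * d + 1)) := fun d => by
    rw [pow_succ, pow_succ, pow_mul, pow_mul, neg_sq, Complex.I_sq, oddSign_natCast]
    push_cast
    ring
  simp only [e0, e1, tsum_zero, tsum_mul_left, zero_add] at h
  rw [← hI.tsum_sub hI', h]

open Complex in
lemma hasSum_oddSign_div_pow_four_even {x : ℝ} (hx : 0 < x) :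
    HasSum (fun k : ℤ => (oddSign (2 * k) : ℂ) / ((oddFreq (2 * k) : ℂ) + I * x) ^ 4)
      (π ^ 4 / 96 * ∑' n : ℕ, (n : ℂ) ^ 3 * rexp (-(n * (π / 2 * x))) * I ^ n) := by
  have h1 : cexp ((1 : ℝ) * (π / 2 * I)) = I := by
    rw [ofReal_one, one_mul, exp_pi_div_two_mul_I]
  have hA := hasSum_one_div_shift_pow_four hx 1
  rw [h1] at hA
  refine hA.congr_fun fun k => ?_
  rw [oddSign_two_mul, oddFreq]
  push_cast
  ring_nf

open Complex in
lemma hasSum_oddSign_div_pow_four_odd {x : ℝ} (hx : 0 < x) :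
    HasSum (fun k : ℤ => (oddSign (2 * k + 1) : ℂ) / ((oddFreq (2 * k + 1) : ℂ) + I * x) ^ 4)
      (-(π ^ 4 / 96 * ∑' n : ℕ, (n : ℂ) ^ 3 * rexp (-(n * (π / 2 * x))) * (-I) ^ n)) := by
  have h3 : cexp ((3 : ℝ) * (π / 2 * I)) = -I := by
    rw [show ((3 : ℝ) : ℂ) * (π / 2 * I) = π / 2 * I + π * I by push_cast; ring, Complex.exp_add,
      exp_pi_mul_I, exp_pi_div_two_mul_I, mul_neg_one]
  have hB := hasSum_one_div_shift_pow_four hx 3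
  rw [h3] at hB
  refine hB.neg.congr_fun fun k => ?_
  rw [oddSign_two_mul_add_one, oddFreq]
  push_cast
  ring_nf

open Complex in
/-- The Lipschitz formula with character mod 4. -/
lemma tsum_oddSign_div_pow_four {x : ℝ} (hx : 0 < x) :
    ∑' m : ℤ, (oddSign m : ℂ) / ((oddFreq m : ℂ) + I * x) ^ 4
      = I * π ^ 4 / 48 *
        ∑' d : ℕ, (oddSign d : ℂ) * (oddFreq d ^ 3 * rexp (-(oddFreq d * (π / 2 * x)))) := by
  have hf : Summable fun n : ℕ => ‖(n : ℂ) ^ 3 * rexp (-(n * (π / 2 * x)))‖ := by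
    refine (Real.summable_pow_mul_exp_neg_nat_mul 3 (r := π / 2 * x) (by positivity)).congr
      fun n => ?_
    rw [norm_mul, norm_pow, Complex.norm_natCast, Complex.norm_real, norm_eq_abs,
      abs_of_pos (Real.exp_pos _)]
    ring_nf
  have h := tsum_mul_I_pow_sub hf
  have e : ∀ d : ℕ, oddFreq d = ((2 * d + 1 : ℕ) : ℝ) := fun d => by simp [oddFreq]
  rw [(hasSum_int_even_add_odd (f := fun m : ℤ => (oddSign m : ℂ) / ((oddFreq m : ℂ) + I * x) ^ 4)
    (hasSum_oddSign_div_pow_four_even hx) (hasSum_oddSign_div_pow_four_odd hx)).tsum_eq]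
  simp only [e, ofReal_natCast]
  linear_combination (π ^ 4 / 96 : ℂ) * h

lemma hasSum_oddSign_mul_exp {a : ℝ} (ha : 0 < a) :
    HasSum (fun j : ℕ => oddSign j * exp (-(oddFreq j * a))) (1 / (2 * cosh a)) := by
  have h1 : |-exp (-(2 * a))| < 1 := by
    rw [abs_neg, abs_of_pos (exp_pos _), exp_lt_one_iff]
    linarith
  have h := (hasSum_geometric_of_abs_lt_one h1).mul_left (exp (-a))
  have e : exp (-a) * (1 - -exp (-(2 * a)))⁻¹ = 1 / (2 * cosh a) := by
    have h2 : exp (-(2 * a)) = exp (-a) ^ 2 := by rw [← exp_nat_mul]; push_cast; ring_nf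
    have h3 : exp a = (exp (-a))⁻¹ := by rw [exp_neg, inv_inv]
    have := exp_pos (-a)
    rw [h2, cosh_eq, h3, sub_neg_eq_add]
    field_simp
  rw [e] at h
  refine h.congr_fun fun j => ?_
  rw [oddSign_natCast, neg_pow (exp _), ← exp_nat_mul, mul_left_comm, ← exp_add, oddFreq]
  congr 2
  push_cast
  ring

lemma summable_oddFreq_pow_mul_exp {c : ℝ} (hc : 0 < c) :
    Summable fun p : ℕ × ℕ => oddSign p.1 * (oddSign p.2 *
      (oddFreq p.2 ^ 3 * exp (-(oddFreq p.2 * (c * oddFreq p.1))))) := by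
  have hE := Real.summable_pow_mul_exp_neg_nat_mul 0 hc
  have hD := (Real.summable_pow_mul_exp_neg_nat_mul 3 hc).comp_injective
    (i := fun n : ℕ => 2 * n + 1) fun a b h => by simpa using h
  refine Summable.of_norm_bounded (summable_mul_of_summable_norm hE.norm hD.norm) fun p => ?_
  obtain ⟨j, d⟩ := p
  have hd : oddFreq d = 2 * (d : ℝ) + 1 := by simp [oddFreq]
  have hj : oddFreq j = 2 * (j : ℝ) + 1 := by simp [oddFreq]
  simp only [Function.comp, norm_mul, norm_eq_abs, abs_exp, hd, hj]
  rw [abs_of_nonneg (by positivity : (0 : ℝ) ≤ (2 * d + 1) ^ 3)]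
  calc |oddSign j| * (|oddSign d| * ((2 * (d : ℝ) + 1) ^ 3 *
        exp (-((2 * d + 1) * (c * (2 * j + 1))))))
      ≤ 1 * (1 * ((2 * (d : ℝ) + 1) ^ 3 * exp (-((2 * d + 1) * (c * (2 * j + 1)))))) := by
        gcongr <;> exact abs_oddSign_le_one _
    _ ≤ 1 * (1 * ((2 * (d : ℝ) + 1) ^ 3 * exp (-c * j + -c * (2 * d + 1)))) := by
        gcongr
        have : 0 ≤ c * (j * (4 * d + 1)) := by positivity
        linarith
    _ = _ := by
        rw [exp_add]
        push_cast
        ring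

lemma oddEis_eq {t : ℝ} (ht : 0 < t) :
    oddEis t = Complex.I * π ^ 4 / 96 *
      (sinSeries oddFreq (sechCoeff (π / 2 * t) 3) (π / 2) : ℝ) := by
  have hc : 0 < π / 2 * t := by positivity
  have hs := summable_oddEisSummand ht
  have hrefl : ∀ j : ℤ, ∑' m, oddEisSummand t (oddNeg j) m = ∑' m, oddEisSummand t j m := by
    intro j
    rw [← oddNeg.tsum_eq]
    refine tsum_congr fun m => ?_
    simp only [oddEisSummand, oddSign_oddNeg, oddFreq_oddNeg]
    push_cast
    rw [neg_mul_neg, mul_neg, mul_neg, ← neg_add, Even.neg_pow (by decide)]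
  have hrow : ∀ j : ℕ, ∑' m, oddEisSummand t j m = Complex.I * π ^ 4 / 48 *
      ((∑' d : ℕ, oddSign j * (oddSign d *
        (oddFreq d ^ 3 * exp (-(oddFreq d * (π / 2 * t * oddFreq j)))))) : ℝ) := by
    intro j
    have hj : 0 < t * oddFreq j := by
      have : oddFreq j = 2 * (j : ℝ) + 1 := by simp [oddFreq]
      rw [this]
      positivity
    simp only [oddEisSummand, mul_div_assoc]
    have h := tsum_oddSign_div_pow_four hj
    push_cast at h
    rw [tsum_mul_left, h, tsum_mul_left]
    push_cast
    simp only [mul_assoc]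
    ring
  have hsum := summable_oddFreq_pow_mul_exp hc
  have hcol : ∀ d : ℕ, ∑' j : ℕ, oddSign j * (oddSign d *
      (oddFreq d ^ 3 * exp (-(oddFreq d * (π / 2 * t * oddFreq j)))))
      = 1 / 2 * (sechCoeff (π / 2 * t) 3 d * sin (oddFreq d * (π / 2))) := by
    intro d
    have hd : 0 < oddFreq d * (π / 2 * t) := by
      have : oddFreq d = 2 * (d : ℝ) + 1 := by simp [oddFreq]
      rw [this]
      positivity
    refine ((hasSum_oddSign_mul_exp hd).mul_left (oddSign d * oddFreq d ^ 3)).congr_fun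
      (fun j => by ring_nf) |>.tsum_eq.trans ?_
    rw [sechCoeff, ← oddSign]
    have := (cosh_pos (oddFreq d * (π / 2 * t))).ne'
    field_simp
  have hsum' : Summable (Function.uncurry fun j d : ℕ => oddSign j * (oddSign d *
      (oddFreq d ^ 3 * exp (-(oddFreq d * (π / 2 * t * oddFreq j)))))) := hsum
  rw [oddEis, tsum_int_eq_two_mul hs.prod hrefl]
  simp only [hrow]
  rw [tsum_mul_left, ← Complex.ofReal_tsum, ← hsum'.tsum_comm]
  simp only [hcol]
  rw [sinSeries, tsum_int_eq_two_mul
    (summable_mul_sin (summable_sechCoeff hc 3) fun j => oddFreq j * (π / 2)) fun j => by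
      simp only [sechCoeff, oddFreq_oddNeg, neg_mul, cosh_neg, sin_neg]; ring, tsum_mul_left]
  push_cast
  ring

lemma sinSeries_sechCoeff_three_inv {t : ℝ} (ht : 0 < t) :
    sinSeries oddFreq (sechCoeff (π / 2 * (1 / t)) 3) (π / 2)
      = -t ^ 4 * sinSeries oddFreq (sechCoeff (π / 2 * t) 3) (π / 2) := by
  have h := oddEis_inv ht
  rw [oddEis_eq ht, oddEis_eq (one_div_pos.2 ht)] at h
  have hc : Complex.I * (π : ℂ) ^ 4 / 96 ≠ 0 := by simp [pi_ne_zero]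
  have h' := mul_left_cancel₀ hc (h.trans (mul_left_comm _ _ _))
  exact_mod_cast h'

/-! ### Differentiating the transformation law -/

lemma eq_neg_five_mul_deriv_of_inv {P Q : ℝ → ℝ} {R : ℝ} (hP : ∀ t, 0 < t → HasDerivAt P (Q t) t)
    (hQ : HasDerivAt Q R 1) (h : ∀ t, 0 < t → P (1 / t) = -t ^ 4 * P t) :
    P 1 = 0 ∧ R = -5 * Q 1 := by
  have hP1 : P 1 = 0 := by
    have := h 1 one_pos
    norm_num at this
    linarith
  have hinv : ∀ t : ℝ, 0 < t → HasDerivAt (fun t : ℝ => 1 / t) (-(1 / t ^ 2)) t := fun t ht => by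
    simpa using hasDerivAt_inv ht.ne'
  have hpow : ∀ (n : ℕ) (t : ℝ), HasDerivAt (fun t : ℝ => t ^ n) (n * t ^ (n - 1)) t :=
    fun n t => hasDerivAt_pow n t
  have hQinv : ∀ t, 0 < t → Q (1 / t) = 4 * t ^ 5 * P t + t ^ 6 * Q t := fun t ht => by
    have h1 : HasDerivAt (fun t => P (1 / t)) (Q (1 / t) * -(1 / t ^ 2)) t :=
      (hP _ (one_div_pos.2 ht)).comp t (hinv t ht)
    have h2 := (hpow 4 t).neg.mul (hP t ht)
    have h3 : (fun t => P (1 / t)) =ᶠ[𝓝 t] fun t => -t ^ 4 * P t := by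
      filter_upwards [lt_mem_nhds ht] with u hu using h u hu
    have h4 := (h1.congr_of_eventuallyEq h3.symm).unique h2
    simp only [Pi.neg_apply] at h4
    field_simp at h4
    push_cast at h4
    linarith
  have h1 : HasDerivAt (fun t => Q (1 / t)) (R * -(1 / 1 ^ 2)) 1 := by
    refine HasDerivAt.comp (h₂ := Q) (1 : ℝ) ?_ (hinv 1 one_pos)
    simpa using hQ
  have h2 := (((hpow 5 1).const_mul 4).mul (hP 1 one_pos)).add ((hpow 6 1).mul hQ)
  have h3 : (fun t => Q (1 / t)) =ᶠ[𝓝 1] fun t => 4 * t ^ 5 * P t + t ^ 6 * Q t := by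
    filter_upwards [lt_mem_nhds one_pos] with u hu using hQinv u hu
  have h4 := (h1.congr_of_eventuallyEq h3.symm).unique h2
  norm_num [hP1] at h4
  exact ⟨hP1, by linarith⟩

/-- Coefficients of the `sech ^ 3` series. -/
noncomputable def sechCubedCoeff (y : ℝ) (k : ℕ) (j : ℤ) : ℝ :=
  oddFreq j ^ k / cosh (oddFreq j * y) ^ 3

lemma summable_sechCubedCoeff {y : ℝ} (hy : 0 < y) (k : ℕ) : Summable (sechCubedCoeff y k) := by
  refine Summable.of_norm_bounded (summable_sechCoeff hy k).abs fun j => ?_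
  rw [sechCubedCoeff, sechCoeff, norm_eq_abs, abs_div, abs_div, abs_pow (cosh _),
    abs_of_pos (cosh_pos _)]
  gcongr
  exact le_self_pow₀ (one_le_cosh _) (by norm_num)

lemma hasDerivAt_param_sinSeries_sechCoeff (k : ℕ) (u : ℝ) {y : ℝ} (hy : 0 < y) :
    HasDerivAt (fun y => sinSeries oddFreq (sechCoeff y k) u)
      (-sinSeries oddFreq (sechTanhCoeff y (k + 1)) u) y := by
  have hb := (summable_sechCoeff (half_pos hy) (k + 1)).abs
  have h := hasDerivAt_tsum_of_isPreconnected (t := Set.Ioi (y / 2)) (y := y) (y₀ := y)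
    (g := fun j z => sechCoeff z k j * sin (oddFreq j * u))
    (g' := fun j z => -(sechTanhCoeff z (k + 1) j * sin (oddFreq j * u))) hb
    isOpen_Ioi isPreconnected_Ioi (fun j z hz => ?_) (fun j z hz => ?_)
    (Set.mem_Ioi.2 (half_lt_self hy))
    (summable_mul_sin (summable_sechCoeff hy k) fun j => oddFreq j * u)
    (Set.mem_Ioi.2 (half_lt_self hy))
  · rw [tsum_neg] at h
    exact h
  · have hc := (cosh_pos (oddFreq j * z)).ne'
    have h1 := (((hasDerivAt_id z).const_mul (oddFreq j)).cosh)
    have h2 := ((h1.inv hc).const_mul (oddFreq j ^ k)).mul_const (sin (oddFreq j * u))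
    refine (h2.congr_deriv ?_).congr_of_eventuallyEq (.of_forall fun x => ?_)
    · rw [sechTanhCoeff, tanh_eq_sinh_div_cosh]
      simp only [id, pow_succ]
      field_simp
    · simp [sechCoeff, div_eq_mul_inv]
  · have hz' : y / 2 < z := hz
    have hy2 := half_pos hy
    rw [norm_neg, norm_mul, sechTanhCoeff, sechCoeff, norm_eq_abs, norm_eq_abs, abs_div, abs_div,
      abs_mul, abs_of_pos (cosh_pos _), abs_of_pos (cosh_pos _)]
    calc _ ≤ |oddFreq j ^ (k + 1)| * 1 / cosh (oddFreq j * (y / 2)) * 1 := by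
          gcongr
          · exact abs_tanh_le_one _
          · rw [cosh_le_cosh, abs_mul, abs_mul, abs_of_pos hy2, abs_of_pos (hy2.trans hz')]
            gcongr
          · exact abs_sin_le_one _
      _ = _ := by ring

lemma hasDerivAt_param_sinSeries_sechTanhCoeff (k : ℕ) (u : ℝ) {y : ℝ} (hy : 0 < y) :
    HasDerivAt (fun y => sinSeries oddFreq (sechTanhCoeff y k) u)
      (2 * sinSeries oddFreq (sechCubedCoeff y (k + 1)) u
        - sinSeries oddFreq (sechCoeff y (k + 1)) u) y := by
  have hb := (summable_sechCoeff (half_pos hy) (k + 1)).abs.mul_left 3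
  have h := hasDerivAt_tsum_of_isPreconnected (t := Set.Ioi (y / 2)) (y := y) (y₀ := y)
    (g := fun j z => sechTanhCoeff z k j * sin (oddFreq j * u))
    (g' := fun j z => 2 * (sechCubedCoeff z (k + 1) j * sin (oddFreq j * u))
      - sechCoeff z (k + 1) j * sin (oddFreq j * u)) hb
    isOpen_Ioi isPreconnected_Ioi (fun j z hz => ?_) (fun j z hz => ?_)
    (Set.mem_Ioi.2 (half_lt_self hy))
    (summable_mul_sin (summable_sechTanhCoeff hy k) fun j => oddFreq j * u)
    (Set.mem_Ioi.2 (half_lt_self hy))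
  · have h1 := (summable_mul_sin (summable_sechCubedCoeff hy (k + 1))
      fun j => oddFreq j * u).mul_left 2
    have h2 := summable_mul_sin (summable_sechCoeff hy (k + 1)) fun j => oddFreq j * u
    rw [h1.tsum_sub h2, tsum_mul_left] at h
    exact h
  · have hc := (cosh_pos (oddFreq j * z)).ne'
    have hl := (hasDerivAt_id z).const_mul (oddFreq j)
    have h2 := (((hl.sinh).div ((hl.cosh).pow 2) (pow_ne_zero 2 hc)).const_mul
      (oddFreq j ^ k)).mul_const (sin (oddFreq j * u))
    refine (h2.congr_deriv ?_).congr_of_eventuallyEq (.of_forall fun x => ?_)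
    · have hs := cosh_sq (oddFreq j * z)
      rw [sechCubedCoeff, sechCoeff]
      simp only [id, Pi.pow_apply]
      have hs' : sinh (oddFreq j * z) ^ 2 = cosh (oddFreq j * z) ^ 2 - 1 := by linarith
      field_simp
      rw [hs']
      ring
    · have hc := (cosh_pos (oddFreq j * x)).ne'
      simp only [sechTanhCoeff, tanh_eq_sinh_div_cosh, id, Pi.div_apply, Pi.pow_apply]
      field_simp
  · have hz' : y / 2 < z := hz
    have hy2 := half_pos hy
    have hle : cosh (oddFreq j * (y / 2)) ≤ cosh (oddFreq j * z) := by
      rw [cosh_le_cosh, abs_mul, abs_mul, abs_of_pos hy2, abs_of_pos (hy2.trans hz')]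
      gcongr
    have h1 : |sechCoeff z (k + 1) j| ≤ |sechCoeff (y / 2) (k + 1) j| := by
      rw [sechCoeff, sechCoeff, abs_div, abs_div, abs_of_pos (cosh_pos _), abs_of_pos (cosh_pos _)]
      gcongr
    have h2 : |sechCubedCoeff z (k + 1) j| ≤ |sechCoeff z (k + 1) j| := by
      rw [sechCubedCoeff, sechCoeff, abs_div, abs_div, abs_pow (cosh _), abs_of_pos (cosh_pos _)]
      gcongr
      exact le_self_pow₀ (one_le_cosh _) (by norm_num)
    have h3 := abs_sin_le_one (oddFreq j * u)
    rw [norm_eq_abs]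
    calc _ ≤ 2 * (|sechCubedCoeff z (k + 1) j| * |sin (oddFreq j * u)|)
          + |sechCoeff z (k + 1) j| * |sin (oddFreq j * u)| := by
          refine (abs_sub _ _).trans_eq ?_
          rw [abs_mul, abs_mul, abs_mul, abs_two]
      _ ≤ 2 * (|sechCoeff (y / 2) (k + 1) j| * 1) + |sechCoeff (y / 2) (k + 1) j| * 1 := by
          have := mul_le_mul (h2.trans h1) h3 (abs_nonneg _) (abs_nonneg _)
          gcongr
      _ = _ := by ring

lemma sinSeries_sechCubedCoeff :
    sinSeries oddFreq (sechCoeff (π / 2) 3) (π / 2) = 0 ∧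
    2 * sinSeries oddFreq (sechCubedCoeff (π / 2) 5) (π / 2)
      = sinSeries oddFreq (sechCoeff (π / 2) 5) (π / 2)
        - 10 / π * sinSeries oddFreq (sechTanhCoeff (π / 2) 4) (π / 2) := by
  have hlin : ∀ t : ℝ, HasDerivAt (fun t : ℝ => π / 2 * t) (π / 2) t := fun t => by
    simpa using (hasDerivAt_id t).const_mul (π / 2)
  have hy : π / 2 * 1 = π / 2 := mul_one _
  have h := eq_neg_five_mul_deriv_of_inv
    (P := fun t => sinSeries oddFreq (sechCoeff (π / 2 * t) 3) (π / 2))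
    (Q := fun t => -sinSeries oddFreq (sechTanhCoeff (π / 2 * t) 4) (π / 2) * (π / 2))
    (R := -((2 * sinSeries oddFreq (sechCubedCoeff (π / 2) 5) (π / 2)
      - sinSeries oddFreq (sechCoeff (π / 2) 5) (π / 2)) * (π / 2)) * (π / 2))
    (fun t ht => (hasDerivAt_param_sinSeries_sechCoeff 3 (π / 2) (by positivity)).comp t (hlin t))
    (by
      refine (HasDerivAt.comp (h₂ := fun y => sinSeries oddFreq (sechTanhCoeff y 4) (π / 2))
        (1 : ℝ) ?_ (hlin 1)).neg.mul_const (π / 2)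
      rw [hy]
      exact hasDerivAt_param_sinSeries_sechTanhCoeff 4 (π / 2) (half_pos pi_pos))
    fun t ht => sinSeries_sechCoeff_three_inv ht
  simp only [hy] at h
  refine ⟨h.1, ?_⟩
  have h2 := h.2
  field_simp at h2 ⊢
  linarith

end HyperbolicSeries

open HyperbolicSeries

theorem sum_odd_fifth_cosh_cubed :
    (∑' n : ℕ, (-1 : ℝ) ^ n * (2*(n:ℝ)+1) ^ 5 / Real.cosh ((2*(n:ℝ)+1) * π / 2) ^ 3) =
      -(3 * Real.Gamma (1/4) ^ 12 / (2 ^ 9 * π ^ 9))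
    + 5 * Real.Gamma (1/4) ^ 12 / (2 ^ 8 * π ^ 10) := by
  have hy := half_pos pi_pos
  obtain ⟨h3, hX⟩ := sinSeries_sechCubedCoeff
  have h1 := sinSeries_sechCoeff_one_half_pi h3
  have hG : 0 < Gamma (1 / 4) := Gamma_pos_of_pos (by norm_num)
  have hpi := pi_pos
  obtain ⟨h5, hT, -⟩ := lemniscatic_identities hy h3 (by rw [h1]; positivity)
  rw [h5, hT, h1] at hX
  generalize hS : (∑' n : ℕ, (-1 : ℝ) ^ n * (2*(n:ℝ)+1) ^ 5 /
    Real.cosh ((2*(n:ℝ)+1) * π / 2) ^ 3) = S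
  have hsum : sinSeries oddFreq (sechCubedCoeff (π / 2) 5) (π / 2)
      = 2 * S := by
    rw [← hS, sinSeries, tsum_int_eq_two_mul
      (summable_mul_sin (summable_sechCubedCoeff hy 5) fun j => oddFreq j * (π / 2)) fun j => by
        simp only [sechCubedCoeff, oddFreq_oddNeg, neg_mul, cosh_neg, sin_neg]; ring]
    congr 1
    refine tsum_congr fun n => ?_
    rw [← oddSign, oddSign_natCast, sechCubedCoeff, oddFreq, mul_div_assoc (2 * (n : ℝ) + 1)]
    push_cast
    ring
  rw [hsum] at hX
  field_simp at hX ⊢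
  linarith
end

section
/- Σ_{n=0}^∞ (−1)^n (2n+1)^7 / cosh((2n+1)π/2)^3 = 63Γ^12/(2^8 π^11) − 13Γ^20/(2^14 π^15), where Γ = Γ(1/4). -/
open Real

namespace SechCubed

open UpperHalfPlane hiding I
open Complex Filter EisensteinSeries Derivative ModularGroup
open scoped Manifold MatrixGroups ModularForm Topology ArithmeticFunction.sigma

/-- A weight `k < 12` level one invariant function vanishing at `i∞` is zero. -/
lemma eq_zero_of_slash_of_tendsto {k : ℤ} (hk : k < 12) {F : ℍ → ℂ} (hF : MDiff F)
    (hS : F ∣[k] S = F) (hT : F ∣[k] T = F) (h0 : Tendsto F atImInfty (𝓝 0)) (z : ℍ) :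
    F z = 0 := by
  let f : CuspForm 𝒮ℒ k :=
    { toFun := F
      slash_action_eq' := by
        rintro A ⟨A, rfl⟩
        exact SlashInvariantForm.slash_action_generators_SL2Z hS hT A
      holo' := hF
      zero_at_cusps' := by
        intro c hc
        rw [Subgroup.IsArithmetic.isCusp_iff_isCusp_SL2Z] at hc
        rw [OnePoint.isZeroAt_iff_forall_SL2Z hc]
        intro γ _
        rw [SlashInvariantForm.slash_action_generators_SL2Z hS hT]
        exact h0 }
  have hf : f = 0 := rank_zero_iff_forall_zero.mp (CuspForm.rank_eq_zero_of_weight_lt_twelve hk) f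
  have : f z = 0 := by rw [hf]; rfl
  exact this

/-- `F` has the `q`-expansion with coefficients `c` on the whole upper half plane. -/
def HasQExp (F : ℍ → ℂ) (c : ℕ → ℂ) : Prop :=
  ∀ τ : ℍ, HasSum (fun m ↦ c m * cexp (2 * π * I * τ) ^ m) (F τ)

lemma norm_cexp_two_pi_I (z : ℂ) : ‖cexp (2 * π * I * z)‖ = Real.exp (-(2 * π * z.im)) := by
  rw [norm_exp]
  simp

namespace HasQExp

variable {F : ℍ → ℂ} {c : ℕ → ℂ}

lemma summable_norm (h : HasQExp F c) {y : ℝ} (hy : 0 < y) :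
    Summable fun m ↦ ‖c m‖ * Real.exp (-(2 * π * y)) ^ m := by
  have := (h ⟨y * I, by simpa using hy⟩).summable.norm
  simpa only [norm_mul, norm_pow, norm_cexp_two_pi_I, mul_im, ofReal_re, Complex.I_im, mul_one,
    ofReal_im, Complex.I_re, mul_zero, add_zero] using this

lemma comp_ofComplex (h : HasQExp F c) {z : ℂ} (hz : 0 < z.im) :
    (F ∘ ofComplex) z = ∑' m, c m * cexp (2 * π * I * z) ^ m := by
  rw [Function.comp_apply, ofComplex_apply_of_im_pos hz]
  exact (h ⟨z, hz⟩).tsum_eq.symm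

lemma norm_term_le (c : ℕ → ℂ) {y : ℝ} {z : ℂ} (hz : y ≤ z.im) (m : ℕ) :
    ‖c m * cexp (2 * π * I * z) ^ m‖ ≤ ‖c m‖ * Real.exp (-(2 * π * y)) ^ m := by
  rw [norm_mul, norm_pow, norm_cexp_two_pi_I]
  gcongr

lemma mdiff (h : HasQExp F c) : MDiff F := by
  rw [UpperHalfPlane.mdifferentiable_iff]
  intro z hz
  have hz' : 0 < z.im := hz
  have hU : IsOpen {w : ℂ | z.im / 2 < w.im} := isOpen_lt continuous_const continuous_im
  have hd := differentiableOn_tsum_of_summable_norm (h.summable_norm (half_pos hz'))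
    (F := fun m w ↦ c m * cexp (2 * π * I * w) ^ m) (U := {w : ℂ | z.im / 2 < w.im})
    (fun m ↦ by fun_prop) hU (fun m w hw ↦ norm_term_le c (le_of_lt hw) m)
  have hmem : {w : ℂ | z.im / 2 < w.im} ∈ 𝓝 z := hU.mem_nhds (by simp [hz'])
  refine ((hd.differentiableAt hmem).congr_of_eventuallyEq ?_).differentiableWithinAt
  filter_upwards [hmem] with w hw
  exact h.comp_ofComplex ((half_pos hz').trans hw)

lemma derivative (h : HasQExp F c) : HasQExp (D F) (fun m ↦ m * c m) := by
  intro τ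
  have hz' : 0 < (τ : ℂ).im := τ.im_pos
  have hU : IsOpen {w : ℂ | (τ : ℂ).im / 2 < w.im} := isOpen_lt continuous_const continuous_im
  have hd := hasSum_deriv_of_summable_norm (h.summable_norm (half_pos hz'))
    (F := fun m w ↦ c m * cexp (2 * π * I * w) ^ m) (U := {w : ℂ | (τ : ℂ).im / 2 < w.im})
    (fun m ↦ by fun_prop) hU (fun m w hw ↦ norm_term_le c (le_of_lt hw) m)
    (z := τ) (by simp only [Set.mem_ofPred_eq]; linarith)
  have hmem : {w : ℂ | (τ : ℂ).im / 2 < w.im} ∈ 𝓝 (τ : ℂ) :=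
    hU.mem_nhds (by simp only [Set.mem_ofPred_eq]; linarith)
  have he : F ∘ ofComplex =ᶠ[𝓝 (τ : ℂ)] fun w ↦ ∑' m, c m * cexp (2 * π * I * w) ^ m := by
    filter_upwards [hmem] with w hw
    exact h.comp_ofComplex ((half_pos hz').trans hw)
  rw [normalizedDerivOfComplex, he.deriv_eq]
  convert! hd.mul_left (2 * π * I)⁻¹ using 2 with m
  have hder : HasDerivAt (fun w : ℂ ↦ c m * cexp (2 * π * I * w) ^ m)
      (c m * (m * cexp (2 * π * I * τ) ^ (m - 1) * (cexp (2 * π * I * τ) * (2 * π * I * 1))))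
      (τ : ℂ) :=
    ((((hasDerivAt_id (τ : ℂ)).const_mul (2 * π * I)).cexp).pow m).const_mul (c m)
  rw [hder.deriv]
  rcases m with _ | m
  · simp
  · have := two_pi_I_ne_zero
    simp only [Nat.add_sub_cancel, pow_succ]
    field_simp

lemma tendsto (h : HasQExp F c) : Tendsto F atImInfty (𝓝 (c 0)) := by
  have key : Tendsto (fun τ : ℍ ↦ ∑' m, c m * cexp (2 * π * I * τ) ^ m) atImInfty
      (𝓝 (∑' m, if m = 0 then c 0 else 0)) := by
    refine tendsto_tsum_of_dominated_convergence (h.summable_norm one_pos) (fun m ↦ ?_) ?_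
    · rcases eq_or_ne m 0 with rfl | hm
      · simp
      · have : Tendsto (fun τ : ℍ ↦ cexp (2 * π * I * τ)) atImInfty (𝓝 0) := by
          simpa [Function.Periodic.qParam] using qParam_tendsto_atImInfty one_pos
        simpa [hm] using (this.pow m).const_mul (c m)
    · filter_upwards [(atImInfty_mem _).mpr ⟨1, fun z hz ↦ hz⟩] with τ hτ m
      exact norm_term_le c hτ m
  rw [tsum_ite_eq] at key
  exact key.congr fun τ ↦ (h τ).tsum_eq

lemma vadd_one (h : HasQExp F c) (τ : ℍ) : F ((1 : ℝ) +ᵥ τ) = F τ := by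
  refine (h _).unique ?_
  convert h τ using 4 with m
  rw [coe_vadd, ofReal_one, mul_add, mul_one, Complex.exp_add, exp_two_pi_mul_I, one_mul]

lemma slash_T (h : HasQExp F c) (k : ℤ) : F ∣[k] T = F := by
  ext τ
  rw [ModularForm.SL_slash_apply, modular_T_smul, h.vadd_one]
  rw [show denom T τ = 1 by rw [denom_apply]; simp [coe_T]]
  simp

end HasQExp

lemma hasQExp_E2 : HasQExp E2 fun m ↦ if m = 0 then 1 else -24 * σ 1 m := by
  intro τ
  simpa only [smul_eq_mul] using hasSum_qExpansion_E2 (z := τ)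

lemma hasQExp_E {k : ℕ} (hk : 3 ≤ k) (hk2 : Even k) : HasQExp (ModularForm.E hk) fun m ↦
    if m = 0 then 1 else -(2 * k / bernoulli k : ℂ) * σ (k - 1) m := by
  intro τ
  have := ModularForm.hasSum_qExpansion (f := ModularForm.E hk) (h := 1) one_pos
    one_mem_strictPeriods_SL τ
  simpa [E_qExpansion_coeff hk hk2, Function.Periodic.qParam] using this

open ModularForm (E₄ E₆)

lemma slash_eq {k : ℤ} (f : ModularForm 𝒮ℒ k) (γ : SL(2, ℤ)) : (f : ℍ → ℂ) ∣[k] γ = f :=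
  f.slash_action_eq' _ ⟨γ, rfl⟩

lemma hasQExp_E₄ : HasQExp E₄ fun m ↦ if m = 0 then 1 else 240 * σ 3 m := by
  convert! hasQExp_E (k := 4) (by norm_num) ⟨2, rfl⟩ using 4 with m
  have : bernoulli 4 = -1 / 30 := by decide +kernel
  rw [this]; norm_num

lemma hasQExp_E₆ : HasQExp E₆ fun m ↦ if m = 0 then 1 else -504 * σ 5 m := by
  convert! hasQExp_E (k := 6) (by norm_num) ⟨3, rfl⟩ using 4 with m
  have : bernoulli 6 = 1 / 42 := by decide +kernel
  rw [this]; norm_num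

lemma hasQExp_E₈ : HasQExp (ModularForm.E (k := 8) (by norm_num))
    fun m ↦ if m = 0 then 1 else 480 * σ 7 m := by
  convert! hasQExp_E (k := 8) (by norm_num) ⟨4, rfl⟩ using 4 with m
  have : bernoulli 8 = -1 / 30 := by decide +kernel
  rw [this]; norm_num

/-- Ramanujan's formula for the derivative of `E₄`. -/
lemma deriv_E₄ (z : ℍ) : D E₄ z = (E2 z * E₄ z - E₆ z) / 3 := by
  have hF : MDiff (serreDerivative (4 : ℤ) E₄ + (1 / 3 : ℂ) • (E₆ : ℍ → ℂ)) :=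
    (serreDerivative_mdifferentiable _ hasQExp_E₄.mdiff).add (hasQExp_E₆.mdiff.const_smul _)
  have hs (γ : SL(2, ℤ)) : (serreDerivative (4 : ℤ) E₄ + (1 / 3 : ℂ) • (E₆ : ℍ → ℂ)) ∣[(6 : ℤ)] γ =
      serreDerivative (4 : ℤ) E₄ + (1 / 3 : ℂ) • (E₆ : ℍ → ℂ) := by
    rw [SlashAction.add_slash, ModularForm.SL_smul_slash, slash_eq]
    exact congrArg (· + _) (serreDerivative_slash_invariant hasQExp_E₄.mdiff (slash_eq E₄ γ))
  have h0 : Tendsto (serreDerivative (4 : ℤ) E₄ + (1 / 3 : ℂ) • (E₆ : ℍ → ℂ)) atImInfty (𝓝 0) := by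
    have := (hasQExp_E₄.derivative.tendsto.sub
      ((hasQExp_E2.tendsto.const_mul (4 * 12⁻¹)).mul hasQExp_E₄.tendsto)).add
      (hasQExp_E₆.tendsto.const_mul (1 / 3))
    norm_num at this
    refine this.congr fun τ ↦ ?_
    simp only [Pi.add_apply, Pi.smul_apply, serreDerivative_apply, smul_eq_mul]
    push_cast
    ring
  have := eq_zero_of_slash_of_tendsto (by norm_num) hF (hs S) (hs T) h0 z
  simp at this
  linear_combination this

/-- Ramanujan's formula for the derivative of `E₆`. -/
lemma deriv_E₆ (z : ℍ) : D E₆ z = (E2 z * E₆ z - E₄ z ^ 2) / 2 := by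
  have hF : MDiff (serreDerivative (6 : ℤ) E₆ + (1 / 2 : ℂ) • ((E₄ : ℍ → ℂ) * (E₄ : ℍ → ℂ))) :=
    (serreDerivative_mdifferentiable _ hasQExp_E₆.mdiff).add
      ((hasQExp_E₄.mdiff.mul hasQExp_E₄.mdiff).const_smul _)
  have hs (γ : SL(2, ℤ)) :
      (serreDerivative (6 : ℤ) E₆ + (1 / 2 : ℂ) • ((E₄ : ℍ → ℂ) * (E₄ : ℍ → ℂ))) ∣[(8 : ℤ)] γ =
      serreDerivative (6 : ℤ) E₆ + (1 / 2 : ℂ) • ((E₄ : ℍ → ℂ) * (E₄ : ℍ → ℂ)) := by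
    have h := ModularForm.mul_slash_SL2 4 4 γ (E₄ : ℍ → ℂ) E₄
    rw [slash_eq] at h
    rw [SlashAction.add_slash, ModularForm.SL_smul_slash]
    exact congrArg₂ (· + _ • ·)
      (serreDerivative_slash_invariant hasQExp_E₆.mdiff (slash_eq E₆ γ)) h
  have h0 : Tendsto (serreDerivative (6 : ℤ) E₆ + (1 / 2 : ℂ) • ((E₄ : ℍ → ℂ) * (E₄ : ℍ → ℂ)))
      atImInfty (𝓝 0) := by
    have := (hasQExp_E₆.derivative.tendsto.sub
      ((hasQExp_E2.tendsto.const_mul (6 * 12⁻¹)).mul hasQExp_E₆.tendsto)).add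
      ((hasQExp_E₄.tendsto.mul hasQExp_E₄.tendsto).const_mul (1 / 2))
    norm_num at this
    refine this.congr fun τ ↦ ?_
    simp only [Pi.add_apply, Pi.smul_apply, Pi.mul_apply, serreDerivative_apply, smul_eq_mul]
    push_cast
    ring
  have := eq_zero_of_slash_of_tendsto (by norm_num) hF (hs S) (hs T) h0 z
  simp at this
  linear_combination this

lemma E2_slash_S (z : ℍ) : (E2 ∣[(2 : ℤ)] S) z = E2 z + 6 / (π * I) * (z : ℂ)⁻¹ := by
  rw [E2_slash_action, Pi.sub_apply, Pi.smul_apply, D2, denom_S, riemannZeta_two]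
  have h : ((π : ℝ) : ℂ) ≠ 0 := by exact_mod_cast pi_ne_zero
  simp [S]
  field_simp
  ring_nf
  simp

lemma D_E2_slash_S (z : ℍ) : (D E2 ∣[(4 : ℤ)] S) z =
    D E2 z + (2 * π * I)⁻¹ * (2 * (z : ℂ)⁻¹ * E2 z + 6 / (π * I) * (z : ℂ)⁻¹ ^ 2) := by
  have h1 := congrFun (normalizedDerivOfComplex_SL_slash (k := 2) E2_mdifferentiable (γ := S)) z
  have h2 : D (E2 ∣[(2 : ℤ)] S) z =
      D E2 z + (2 * π * I)⁻¹ * (6 / (π * I) * (-((z : ℂ) ^ 2)⁻¹)) := by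
    rw [normalizedDerivOfComplex, normalizedDerivOfComplex, ← mul_add]
    congr 1
    have he : (E2 ∣[(2 : ℤ)] S) ∘ ofComplex =ᶠ[𝓝 (z : ℂ)]
        fun w ↦ (E2 ∘ ofComplex) w + 6 / (π * I) * w⁻¹ := by
      filter_upwards [isOpen_upperHalfPlaneSet.mem_nhds z.im_pos] with w hw
      simp only [Function.comp_apply, E2_slash_S]
      rw [ofComplex_apply_of_im_pos hw]
    rw [he.deriv_eq]
    exact ((UpperHalfPlane.mdifferentiableAt_iff.mp (E2_mdifferentiable z)).hasDerivAt.add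
      ((hasDerivAt_inv (ne_zero z)).const_mul _)).deriv
  rw [h2, Pi.sub_apply, E2_slash_S, denom_S] at h1
  simp [S] at h1
  have h3 : (D E2 ∣[(2 + 2 : ℤ)] S) z = (D E2 ∣[(4 : ℤ)] S) z := rfl
  simp [S] at h3 ⊢
  linear_combination -h1

/-- Ramanujan's formula for the derivative of `E₂`. -/
lemma deriv_E2 (z : ℍ) : D E2 z = (E2 z ^ 2 - E₄ z) / 12 := by
  have hF : MDiff (D E2 + (1 / 12 : ℂ) • ((E₄ : ℍ → ℂ) - E2 * E2)) :=
    (normalizedDerivOfComplex_mdifferentiable E2_mdifferentiable).add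
      ((hasQExp_E₄.mdiff.sub (E2_mdifferentiable.mul E2_mdifferentiable)).const_smul _)
  have hT : (D E2 + (1 / 12 : ℂ) • ((E₄ : ℍ → ℂ) - E2 * E2)) ∣[(4 : ℤ)] T =
      D E2 + (1 / 12 : ℂ) • ((E₄ : ℍ → ℂ) - E2 * E2) := by
    have h := ModularForm.mul_slash_SL2 2 2 T E2 E2
    rw [hasQExp_E2.slash_T] at h
    rw [SlashAction.add_slash, ModularForm.SL_smul_slash, sub_eq_add_neg, SlashAction.add_slash,
      SlashAction.neg_slash, slash_eq, hasQExp_E2.derivative.slash_T]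
    exact congrArg (fun g ↦ D E2 + (1 / 12 : ℂ) • ((E₄ : ℍ → ℂ) + -g)) h
  have hS : (D E2 + (1 / 12 : ℂ) • ((E₄ : ℍ → ℂ) - E2 * E2)) ∣[(4 : ℤ)] S =
      D E2 + (1 / 12 : ℂ) • ((E₄ : ℍ → ℂ) - E2 * E2) := by
    ext τ
    have h : ((E2 * E2) ∣[(4 : ℤ)] S) τ = (E2 ∣[(2 : ℤ)] S) τ * (E2 ∣[(2 : ℤ)] S) τ :=
      congrFun (ModularForm.mul_slash_SL2 2 2 S E2 E2) τ
    rw [SlashAction.add_slash, ModularForm.SL_smul_slash, sub_eq_add_neg, SlashAction.add_slash,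
      SlashAction.neg_slash, slash_eq]
    simp only [Pi.add_apply, Pi.smul_apply, Pi.neg_apply, Pi.mul_apply, h, E2_slash_S,
      D_E2_slash_S, smul_eq_mul]
    have hpi : ((π : ℝ) : ℂ) ≠ 0 := by exact_mod_cast pi_ne_zero
    have := ne_zero τ
    field_simp
    ring
  have h0 : Tendsto (D E2 + (1 / 12 : ℂ) • ((E₄ : ℍ → ℂ) - E2 * E2)) atImInfty (𝓝 0) := by
    have := hasQExp_E2.derivative.tendsto.add ((hasQExp_E₄.tendsto.sub
      (hasQExp_E2.tendsto.mul hasQExp_E2.tendsto)).const_mul (1 / 12))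
    norm_num at this
    refine this.congr fun τ ↦ ?_
    simp only [Pi.add_apply, Pi.smul_apply, Pi.sub_apply, Pi.mul_apply, smul_eq_mul]
  have := eq_zero_of_slash_of_tendsto (by norm_num) hF hS hT h0 z
  simp at this
  linear_combination this

lemma deriv_deriv_E₄ (z : ℍ) : D (D E₄) z =
    5 / 36 * (E2 z ^ 2 * E₄ z - 2 * E2 z * E₆ z + E₄ z ^ 2) := by
  have h : D E₄ = (1 / 3 : ℂ) • (E2 * (E₄ : ℍ → ℂ) - (E₆ : ℍ → ℂ)) := by
    ext z
    simp [deriv_E₄]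
    ring
  have h2 := hasQExp_E2.mdiff
  have h4 := hasQExp_E₄.mdiff
  have h6 := hasQExp_E₆.mdiff
  rw [h, normalizedDerivOfComplex_smul _ _ ((h2.mul h4).sub h6),
    normalizedDerivOfComplex_sub _ _ (h2.mul h4) h6, normalizedDerivOfComplex_mul _ _ h2 h4]
  simp only [Pi.add_apply, Pi.smul_apply, Pi.sub_apply, Pi.mul_apply, smul_eq_mul, deriv_E₄,
    deriv_E₆, deriv_E2]
  ring

lemma deriv_deriv_E₆ (z : ℍ) : D (D E₆) z =
    7 / 24 * (E2 z ^ 2 * E₆ z - 2 * E2 z * E₄ z ^ 2 + E₄ z * E₆ z) := by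
  have h : D E₆ = (1 / 2 : ℂ) • (E2 * (E₆ : ℍ → ℂ) - (E₄ : ℍ → ℂ) * (E₄ : ℍ → ℂ)) := by
    ext z
    simp [deriv_E₆]
    ring
  have h2 := hasQExp_E2.mdiff
  have h4 := hasQExp_E₄.mdiff
  have h6 := hasQExp_E₆.mdiff
  rw [h, normalizedDerivOfComplex_smul _ _ ((h2.mul h6).sub (h4.mul h4)),
    normalizedDerivOfComplex_sub _ _ (h2.mul h6) (h4.mul h4),
    normalizedDerivOfComplex_mul _ _ h2 h6, normalizedDerivOfComplex_mul _ _ h4 h4]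
  simp only [Pi.add_apply, Pi.smul_apply, Pi.sub_apply, Pi.mul_apply, smul_eq_mul, deriv_E₄,
    deriv_E₆, deriv_E2]
  ring

/-- `E₄² = E₈`. -/
lemma E₈_eq (z : ℍ) : ModularForm.E (k := 8) (by norm_num) z = E₄ z ^ 2 := by
  have h4 := hasQExp_E₄
  have h8 := hasQExp_E₈
  set f := ModularForm.E (k := 8) (by norm_num)
  have hs (γ : SL(2, ℤ)) : ((f : ℍ → ℂ) - (E₄ : ℍ → ℂ) * (E₄ : ℍ → ℂ)) ∣[(8 : ℤ)] γ =
      (f : ℍ → ℂ) - (E₄ : ℍ → ℂ) * (E₄ : ℍ → ℂ) := by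
    have h := ModularForm.mul_slash_SL2 4 4 γ (E₄ : ℍ → ℂ) E₄
    rw [slash_eq] at h
    rw [sub_eq_add_neg, SlashAction.add_slash, SlashAction.neg_slash]
    exact congrArg₂ (· + -·) (slash_eq f γ) h
  have h0 : Tendsto ((f : ℍ → ℂ) - (E₄ : ℍ → ℂ) * (E₄ : ℍ → ℂ)) atImInfty (𝓝 0) := by
    have := h8.tendsto.sub (h4.tendsto.mul h4.tendsto)
    norm_num at this
    exact this
  have := eq_zero_of_slash_of_tendsto (by norm_num) (h8.mdiff.sub (h4.mdiff.mul h4.mdiff))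
    (hs S) (hs T) h0 z
  simp at this
  linear_combination this

/-- The matrix `!![a, b; c, d]` acts by the expected formula. -/
lemma exists_smul_eq (a b c d : ℤ) (h : a * d - b * c = 1) {z w : ℍ}
    (hw : (w : ℂ) * (c * z + d) = a * z + b) :
    ∃ γ : SL(2, ℤ), γ • z = w ∧ denom γ z = c * z + d ∧ γ 1 0 = c := by
  let γ : SL(2, ℤ) := ⟨!![a, b; c, d], by rw [Matrix.det_fin_two_of, h]⟩
  have hd : denom γ z = c * z + d := by
    rw [denom_apply]
    simp [γ]
  refine ⟨γ, ?_, hd, rfl⟩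
  ext
  have hne : (c * z + d : ℂ) ≠ 0 := hd ▸ denom_ne_zero _ _
  rw [coe_specialLinearGroup_apply]
  simp only [γ]
  simp
  rw [← hw, mul_div_cancel_right₀ _ hne]

lemma modular_apply {k : ℤ} (f : ModularForm 𝒮ℒ k) (a b c d : ℤ) (h : a * d - b * c = 1)
    {z w : ℍ} (hw : (w : ℂ) * (c * z + d) = a * z + b) : f w = (c * z + d : ℂ) ^ k * f z := by
  obtain ⟨γ, rfl, hd, -⟩ := exists_smul_eq a b c d h hw
  have hne : (c * z + d : ℂ) ≠ 0 := hd ▸ denom_ne_zero _ _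
  have := congrFun (slash_eq f γ) z
  rw [ModularForm.SL_slash_apply, hd, zpow_neg] at this
  rw [← this]
  field_simp

lemma E2_apply (a b c d : ℤ) (h : a * d - b * c = 1) {z w : ℍ}
    (hw : (w : ℂ) * (c * z + d) = a * z + b) :
    E2 w = (c * z + d : ℂ) ^ 2 * E2 z + 6 / (π * I) * c * (c * z + d) := by
  obtain ⟨γ, rfl, hd, hc⟩ := exists_smul_eq a b c d h hw
  have hne : (c * z + d : ℂ) ≠ 0 := hd ▸ denom_ne_zero _ _
  have := congrFun (E2_slash_action γ) z
  rw [ModularForm.SL_slash_apply, Pi.sub_apply, Pi.smul_apply, D2, hd, hc, riemannZeta_two,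
    smul_eq_mul, zpow_neg, ← div_eq_mul_inv, div_eq_iff (zpow_ne_zero _ hne)] at this
  have hpi : ((π : ℝ) : ℂ) ≠ 0 := by exact_mod_cast pi_ne_zero
  rw [this]
  field_simp
  linear_combination -(6 * c : ℂ) * I_sq

/-- The map `τ ↦ a τ + b` of the upper half plane. -/
noncomputable def affine (a : ℝ) (ha : 0 < a) (b : ℝ) (τ : ℍ) : ℍ :=
  ⟨a * τ + b, by simpa using mul_pos ha τ.im_pos⟩

@[simp] lemma coe_affine (a : ℝ) (ha : 0 < a) (b : ℝ) (τ : ℍ) :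
    (affine a ha b τ : ℂ) = a * τ + b := rfl

lemma tendsto_affine (a : ℝ) (ha : 0 < a) (b : ℝ) :
    Tendsto (affine a ha b) atImInfty atImInfty := by
  rw [atImInfty, tendsto_comap_iff]
  refine (tendsto_comap.const_mul_atTop ha).congr fun τ ↦ ?_
  simp [← coe_im]

lemma hasDerivAt_comp_affine {F : ℍ → ℂ} (hF : MDiff F) (a : ℝ) (ha : 0 < a) (b : ℝ) (τ : ℍ) :
    HasDerivAt ((F ∘ affine a ha b) ∘ ofComplex)
      (deriv (F ∘ ofComplex) (affine a ha b τ) * a) τ := by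
  have h1 := (UpperHalfPlane.mdifferentiableAt_iff.mp (hF (affine a ha b τ))).hasDerivAt
  have h2 : HasDerivAt (fun w : ℂ ↦ a * w + b) (a * 1) (τ : ℂ) :=
    ((hasDerivAt_id (τ : ℂ)).const_mul (a : ℂ)).add_const _
  have h3 := HasDerivAt.comp (τ : ℂ) (h₂ := F ∘ ofComplex) h1 h2
  rw [mul_one] at h3
  refine h3.congr_of_eventuallyEq ?_
  filter_upwards [isOpen_upperHalfPlaneSet.mem_nhds τ.im_pos] with w hw
  have : 0 < ((a : ℂ) * w + b).im := by simpa using mul_pos ha hw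
  simp only [Function.comp_apply]
  rw [ofComplex_apply_of_im_pos hw, ofComplex_apply_of_im_pos this]
  rfl

lemma mdiff_comp_affine {F : ℍ → ℂ} (hF : MDiff F) (a : ℝ) (ha : 0 < a) (b : ℝ) :
    MDiff (F ∘ affine a ha b) := fun τ ↦
  UpperHalfPlane.mdifferentiableAt_iff.mpr (hasDerivAt_comp_affine hF a ha b τ).differentiableAt

lemma derivative_comp_affine {F : ℍ → ℂ} (hF : MDiff F) (a : ℝ) (ha : 0 < a) (b : ℝ) :
    D (F ∘ affine a ha b) = (a : ℂ) • (D F ∘ affine a ha b) := by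
  ext τ
  simp only [normalizedDerivOfComplex, (hasDerivAt_comp_affine hF a ha b τ).deriv, Pi.smul_apply,
    Function.comp_apply, smul_eq_mul]
  ring

/-- The weighted sum of the values of `F` over the sublattices of index two. -/
noncomputable def heckeSum (u v : ℂ) (F : ℍ → ℂ) : ℍ → ℂ :=
  u • (F ∘ affine 2 two_pos 0) + v • (F ∘ affine (1 / 2) one_half_pos 0 +
    F ∘ affine (1 / 2) one_half_pos (1 / 2))

lemma heckeSum_mdiff (u v : ℂ) {F : ℍ → ℂ} (hF : MDiff F) : MDiff (heckeSum u v F) :=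
  ((mdiff_comp_affine hF _ _ _).const_smul _).add
    (((mdiff_comp_affine hF _ _ _).add (mdiff_comp_affine hF _ _ _)).const_smul _)

lemma derivative_heckeSum (u v : ℂ) {F : ℍ → ℂ} (hF : MDiff F) :
    D (heckeSum u v F) = heckeSum (2 * u) (v / 2) (D F) := by
  have h1 := mdiff_comp_affine hF 2 two_pos 0
  have h2 := mdiff_comp_affine hF (1 / 2) one_half_pos 0
  have h3 := mdiff_comp_affine hF (1 / 2) one_half_pos (1 / 2)
  rw [heckeSum, normalizedDerivOfComplex_add _ _ (h1.const_smul u) ((h2.add h3).const_smul v),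
    normalizedDerivOfComplex_smul _ _ h1, normalizedDerivOfComplex_smul _ _ (h2.add h3),
    normalizedDerivOfComplex_add _ _ h2 h3]
  simp only [derivative_comp_affine hF]
  ext τ
  simp [heckeSum]
  ring

/-- A level one modular form of weight `k < 12` with constant term one is an eigenform for the
Hecke operator `T₂`. -/
lemma heckeSum_eq {k : ℕ} (hk : k < 12) (f : ModularForm 𝒮ℒ k) (hf : MDiff f)
    (h1 : Tendsto f atImInfty (𝓝 1)) :
    heckeSum (2 ^ k / 2) (1 / 2) f = (2 ^ k / 2 + 1 : ℂ) • (f : ℍ → ℂ) := by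
  have hF : MDiff (heckeSum (2 ^ k / 2) (1 / 2) f - (2 ^ k / 2 + 1 : ℂ) • (f : ℍ → ℂ)) :=
    (heckeSum_mdiff _ _ hf).sub (hf.const_smul _)
  have hinf : Tendsto (heckeSum (2 ^ k / 2) (1 / 2) f - (2 ^ k / 2 + 1 : ℂ) • (f : ℍ → ℂ))
      atImInfty (𝓝 0) := by
    have := (((h1.comp (tendsto_affine 2 two_pos 0)).const_mul (2 ^ k / 2 : ℂ)).add
      (((h1.comp (tendsto_affine (1 / 2) one_half_pos 0)).add
        (h1.comp (tendsto_affine (1 / 2) one_half_pos (1 / 2)))).const_mul (1 / 2))).sub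
      (h1.const_mul (2 ^ k / 2 + 1))
    rw [show (2 ^ k / 2 * 1 + 1 / 2 * (1 + 1) - (2 ^ k / 2 + 1) * 1 : ℂ) = 0 by ring] at this
    exact this
  have hS : (heckeSum (2 ^ k / 2) (1 / 2) f - (2 ^ k / 2 + 1 : ℂ) • (f : ℍ → ℂ)) ∣[(k : ℤ)] S =
      heckeSum (2 ^ k / 2) (1 / 2) f - (2 ^ k / 2 + 1 : ℂ) • (f : ℍ → ℂ) := by
    rw [sub_eq_add_neg, SlashAction.add_slash, SlashAction.neg_slash, ModularForm.SL_smul_slash,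
      slash_eq]
    congr 1
    ext τ
    have hτ := ne_zero τ
    have hs : ((S • τ : ℍ) : ℂ) = -(τ : ℂ)⁻¹ := by
      rw [modular_S_smul]; simp [inv_neg]
    have a1 := modular_apply f 0 (-1) 1 0 (by norm_num) (z := affine (1 / 2) one_half_pos 0 τ)
      (w := affine 2 two_pos 0 (S • τ))
      (by rw [coe_affine, coe_affine, hs]; push_cast; field_simp; ring)
    have a2 := modular_apply f 0 (-1) 1 0 (by norm_num) (z := affine 2 two_pos 0 τ)
      (w := affine (1 / 2) one_half_pos 0 (S • τ))
      (by rw [coe_affine, coe_affine, hs]; push_cast; field_simp; ring)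
    have a3 := modular_apply f 1 (-1) 2 (-1) (by norm_num)
      (z := affine (1 / 2) one_half_pos (1 / 2) τ)
      (w := affine (1 / 2) one_half_pos (1 / 2) (S • τ))
      (by rw [coe_affine, coe_affine, hs]; push_cast; field_simp; ring)
    rw [ModularForm.SL_slash_apply, denom_S]
    simp only [heckeSum, Pi.add_apply, Pi.smul_apply, Function.comp_apply, smul_eq_mul, a1, a2, a3,
      zpow_neg, zpow_natCast, coe_affine]
    push_cast
    rw [show (2 * (1 / 2 * (τ : ℂ) + 1 / 2) + -1) = τ by ring]
    simp only [one_mul, add_zero, mul_pow, one_div, inv_pow]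
    field_simp
    ring
  have hT' : (heckeSum (2 ^ k / 2) (1 / 2) f - (2 ^ k / 2 + 1 : ℂ) • (f : ℍ → ℂ)) ∣[(k : ℤ)] T =
      heckeSum (2 ^ k / 2) (1 / 2) f - (2 ^ k / 2 + 1 : ℂ) • (f : ℍ → ℂ) := by
    rw [sub_eq_add_neg, SlashAction.add_slash, SlashAction.neg_slash, ModularForm.SL_smul_slash,
      slash_eq]
    congr 1
    ext τ
    have hs : ((T • τ : ℍ) : ℂ) = τ + 1 := by
      rw [modular_T_smul]; simp [add_comm]
    have a1 := modular_apply f 1 2 0 1 (by norm_num) (z := affine 2 two_pos 0 τ)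
      (w := affine 2 two_pos 0 (T • τ))
      (by rw [coe_affine, coe_affine, hs]; push_cast; ring)
    have a2 := modular_apply f 1 0 0 1 (by norm_num) (z := affine (1 / 2) one_half_pos (1 / 2) τ)
      (w := affine (1 / 2) one_half_pos 0 (T • τ))
      (by rw [coe_affine, coe_affine, hs]; push_cast; ring)
    have a3 := modular_apply f 1 1 0 1 (by norm_num)
      (z := affine (1 / 2) one_half_pos 0 τ)
      (w := affine (1 / 2) one_half_pos (1 / 2) (T • τ))
      (by rw [coe_affine, coe_affine, hs]; push_cast; ring)
    rw [ModularForm.SL_slash_apply, show denom T τ = 1 by rw [denom_apply]; simp [coe_T]]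
    simp only [heckeSum, Pi.add_apply, Pi.smul_apply, Function.comp_apply, smul_eq_mul, a1, a2, a3]
    simp
    ring
  ext τ
  exact sub_eq_zero.mp
    (eq_zero_of_slash_of_tendsto (by exact_mod_cast hk) hF hS hT' hinf τ)

/-- The point `x + i y` of the upper half plane. -/
noncomputable def pt (x y : ℝ) (hy : 0 < y) : ℍ := ⟨x + y * I, by simpa using hy⟩

@[simp] lemma coe_pt (x y : ℝ) (hy : 0 < y) : (pt x y hy : ℂ) = x + y * I := rfl

/-- The point `i`. -/
noncomputable def ptI : ℍ := pt 0 1 one_pos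

/-- The point `2 i`. -/
noncomputable def ptTwoI : ℍ := pt 0 2 two_pos

@[simp] lemma coe_ptI : (ptI : ℂ) = I := by simp [ptI]

@[simp] lemma coe_ptTwoI : (ptTwoI : ℂ) = 2 * I := by simp [ptTwoI]

lemma I_pow_six : I ^ 6 = -1 := by
  linear_combination (I ^ 4 - I ^ 2 + 1) * I_sq

lemma E₆_I : E₆ ptI = 0 := by
  have := modular_apply E₆ 0 (-1) 1 0 (by norm_num) (z := ptI) (w := ptI) (by simp)
  norm_num at this
  rw [I_pow_six] at this
  linear_combination this / 2

lemma ofReal_pi_ne_zero' : ((π : ℝ) : ℂ) ≠ 0 := by exact_mod_cast pi_ne_zero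

lemma E2_I : E2 ptI = 3 / π := by
  have := E2_apply 0 (-1) 1 0 (by norm_num) (z := ptI) (w := ptI) (by simp)
  norm_num at this
  have h := ofReal_pi_ne_zero'
  field_simp at this ⊢
  linear_combination this / 2

lemma affine_two_ptI : affine 2 two_pos 0 ptI = ptTwoI := by
  ext; simp

lemma E₄_half_I : E₄ (affine (1 / 2) one_half_pos 0 ptI) = 16 * E₄ ptTwoI := by
  have := modular_apply E₄ 0 (-1) 1 0 (by norm_num) (z := ptTwoI)
    (w := affine (1 / 2) one_half_pos 0 ptI) (by simp; linear_combination I_mul_I)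
  rw [this]
  push_cast
  rw [coe_ptTwoI, show ((1 * (2 * I) + 0 : ℂ) ^ (4 : ℤ)) = (2 * I) ^ 4 by norm_cast; ring_nf]
  linear_combination (16 * (I ^ 2 - 1) * E₄ ptTwoI) * I_sq

lemma E₆_half_I : E₆ (affine (1 / 2) one_half_pos 0 ptI) = -64 * E₆ ptTwoI := by
  have := modular_apply E₆ 0 (-1) 1 0 (by norm_num) (z := ptTwoI)
    (w := affine (1 / 2) one_half_pos 0 ptI) (by simp; linear_combination I_mul_I)
  rw [this]
  push_cast
  rw [coe_ptTwoI, show ((1 * (2 * I) + 0 : ℂ) ^ (6 : ℤ)) = (2 * I) ^ 6 by norm_cast; ring_nf]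
  linear_combination (64 * E₆ ptTwoI) * I_pow_six

lemma E2_half_I : E2 (affine (1 / 2) one_half_pos 0 ptI) = -4 * E2 ptTwoI + 12 / π := by
  have := E2_apply 0 (-1) 1 0 (by norm_num) (z := ptTwoI)
    (w := affine (1 / 2) one_half_pos 0 ptI) (by simp; linear_combination I_mul_I)
  rw [this]
  push_cast
  rw [coe_ptTwoI]
  have h := ofReal_pi_ne_zero'
  field_simp
  linear_combination (4 * π * E2 ptTwoI * I) * I_sq

lemma E₄_half_one_add_I : E₄ (affine (1 / 2) one_half_pos (1 / 2) ptI) = -4 * E₄ ptI := by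
  have := modular_apply E₄ 0 1 (-1) 1 (by norm_num) (z := ptI)
    (w := affine (1 / 2) one_half_pos (1 / 2) ptI) (by simp; linear_combination -I_mul_I / 2)
  rw [this]
  push_cast
  rw [coe_ptI, show ((-1 * I + 1 : ℂ) ^ (4 : ℤ)) = (1 - I) ^ 4 by rw [zpow_ofNat]; ring]
  linear_combination (E₄ ptI * (I ^ 2 - 4 * I + 5)) * I_sq

lemma E₆_half_one_add_I : E₆ (affine (1 / 2) one_half_pos (1 / 2) ptI) = 0 := by
  have := modular_apply E₆ 0 1 (-1) 1 (by norm_num) (z := ptI)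
    (w := affine (1 / 2) one_half_pos (1 / 2) ptI) (by simp; linear_combination -I_mul_I / 2)
  rw [this, E₆_I, mul_zero]

lemma E2_half_one_add_I : E2 (affine (1 / 2) one_half_pos (1 / 2) ptI) = 6 / π := by
  have := E2_apply 0 1 (-1) 1 (by norm_num) (z := ptI)
    (w := affine (1 / 2) one_half_pos (1 / 2) ptI) (by simp; linear_combination -I_mul_I / 2)
  rw [this, E2_I]
  push_cast
  rw [coe_ptI]
  have h := ofReal_pi_ne_zero'
  field_simp
  linear_combination (3 * I - 6) * I_sq

lemma heckeSum_E₄ : heckeSum 8 (1 / 2) E₄ = (9 : ℂ) • (E₄ : ℍ → ℂ) := by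
  have := heckeSum_eq (k := 4) (by norm_num) E₄ hasQExp_E₄.mdiff
    (by simpa using hasQExp_E₄.tendsto)
  norm_num at this
  simpa using this

lemma heckeSum_E₆ : heckeSum 32 (1 / 2) E₆ = (33 : ℂ) • (E₆ : ℍ → ℂ) := by
  have := heckeSum_eq (k := 6) (by norm_num) E₆ hasQExp_E₆.mdiff
    (by simpa using hasQExp_E₆.tendsto)
  norm_num at this
  simpa using this

lemma heckeSum_apply_I (u v : ℂ) (F : ℍ → ℂ) : heckeSum u v F ptI =
    u * F ptTwoI + v * (F (affine (1 / 2) one_half_pos 0 ptI) +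
      F (affine (1 / 2) one_half_pos (1 / 2) ptI)) := by
  simp only [heckeSum, Pi.add_apply, Pi.smul_apply, Function.comp_apply, smul_eq_mul,
    affine_two_ptI]

lemma E₄_two_I : E₄ ptTwoI = 11 / 16 * E₄ ptI := by
  have := congrFun heckeSum_E₄ ptI
  rw [heckeSum_apply_I, E₄_half_I, E₄_half_one_add_I, Pi.smul_apply, smul_eq_mul] at this
  linear_combination this / 16

lemma E2_mul_E₆_two_I :
    (E2 ptTwoI - 3 / (2 * π)) * E₆ ptTwoI = 63 / 256 * E₄ ptI ^ 2 := by
  have hd : D (heckeSum 32 (1 / 2) E₆) = D ((33 : ℂ) • (E₆ : ℍ → ℂ)) := by rw [heckeSum_E₆]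
  have h6 := hasQExp_E₆.mdiff
  rw [derivative_heckeSum _ _ h6, normalizedDerivOfComplex_smul _ _ h6] at hd
  have := congrFun hd ptI
  rw [heckeSum_apply_I, Pi.smul_apply, smul_eq_mul] at this
  simp only [deriv_E₆, E₄_half_I, E₄_half_one_add_I, E₆_half_I, E₆_half_one_add_I, E2_half_I,
    E2_half_one_add_I, E2_I, E₆_I, E₄_two_I] at this
  have h := ofReal_pi_ne_zero'
  field_simp at this ⊢
  linear_combination this / 256

/-- A `q`-expansion with real coefficients evaluated on the imaginary axis. -/
lemma HasQExp.hasSum_ofReal {F : ℍ → ℂ} {c : ℕ → ℝ} (h : HasQExp F fun m ↦ (c m : ℂ)) {y : ℝ}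
    (hy : 0 < y) : HasSum (fun m ↦ c m * Real.exp (-(2 * π * y)) ^ m) (F (pt 0 y hy)).re ∧
      (F (pt 0 y hy)).im = 0 := by
  have h1 : HasSum (fun m ↦ ((c m * Real.exp (-(2 * π * y)) ^ m : ℝ) : ℂ)) (F (pt 0 y hy)) := by
    convert! h (pt 0 y hy) using 2 with m
    push_cast
    congr 3
    simp
    linear_combination -(2 * π * y : ℂ) * I_mul_I
  refine ⟨by simpa only [ofReal_re] using hasSum_re h1, ?_⟩
  exact (by simpa only [ofReal_im] using hasSum_im h1 : HasSum (fun _ : ℕ ↦ (0 : ℝ)) _).unique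
    hasSum_zero

/-- `E₄(i)` is a positive real number. -/
lemma exists_E₄_I : ∃ e : ℝ, 0 < e ∧ E₄ ptI = e := by
  have h : HasQExp E₄ fun m ↦ ((if m = 0 then 1 else 240 * σ 3 m : ℝ) : ℂ) := by
    convert! hasQExp_E₄ using 2 with m
    split_ifs <;> simp
  obtain ⟨h1, h2⟩ := h.hasSum_ofReal one_pos
  refine ⟨(E₄ ptI).re, ?_, Complex.ext rfl h2⟩
  refine lt_of_lt_of_le one_pos (?_ : 1 ≤ (E₄ (pt 0 1 one_pos)).re)
  have := h1.summable.le_tsum 0 (fun m _ ↦ by split_ifs <;> positivity)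
  rw [h1.tsum_eq] at this
  simpa using this

lemma exists_E2_two_I : ∃ p : ℝ, 3 / π ≤ p ∧ E2 ptTwoI = p := by
  have h : HasQExp E2 fun m ↦ ((if m = 0 then 1 else -24 * σ 1 m : ℝ) : ℂ) := by
    convert! hasQExp_E2 using 2 with m
    split_ifs <;> simp
  obtain ⟨h1, -⟩ := h.hasSum_ofReal one_pos
  obtain ⟨h2, h3⟩ := h.hasSum_ofReal two_pos
  refine ⟨(E2 ptTwoI).re, ?_, Complex.ext rfl h3⟩
  have hI : (E2 (pt 0 1 one_pos)).re = 3 / π := by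
    have := congrArg Complex.re E2_I
    rw [show (3 / π : ℂ) = ((3 / π : ℝ) : ℂ) by push_cast; rfl, ofReal_re] at this
    exact this
  rw [← hI]
  refine hasSum_le (fun m ↦ ?_) h1 h2
  rcases eq_or_ne m 0 with rfl | hm
  · simp
  · have h4 : Real.exp (-(2 * π * 2)) ^ m ≤ Real.exp (-(2 * π * 1)) ^ m := by
      gcongr
      norm_num
    have h5 : (0 : ℝ) ≤ σ 1 m := by positivity
    simp only [hm, if_false]
    nlinarith [mul_le_mul_of_nonneg_left h4 h5]

lemma sq_E2_two_I : (E2 ptTwoI - 3 / (2 * π)) ^ 2 = 3 / 16 * E₄ ptI := by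
  have hd : D (D (heckeSum 8 (1 / 2) E₄)) = D (D ((9 : ℂ) • (E₄ : ℍ → ℂ))) := by rw [heckeSum_E₄]
  have h4 := hasQExp_E₄.mdiff
  have h4' := hasQExp_E₄.derivative.mdiff
  rw [derivative_heckeSum _ _ h4, normalizedDerivOfComplex_smul _ _ h4,
    derivative_heckeSum _ _ h4', normalizedDerivOfComplex_smul _ _ h4'] at hd
  have h := ofReal_pi_ne_zero'
  have he : E₄ ptI ≠ 0 := by
    obtain ⟨e, he, h⟩ := exists_E₄_I
    rw [h]
    exact_mod_cast he.ne'
  have hr := E2_mul_E₆_two_I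
  have := congrFun hd ptI
  rw [heckeSum_apply_I, Pi.smul_apply, smul_eq_mul] at this
  simp only [deriv_deriv_E₄, E₄_half_I, E₄_half_one_add_I, E₆_half_I, E₆_half_one_add_I, E2_half_I,
    E2_half_one_add_I, E2_I, E₆_I, E₄_two_I] at this
  refine mul_left_cancel₀ he ?_
  have e1 : (3 / π : ℂ) = 2 * (3 / (2 * π)) := by field_simp
  have e2 : (6 / π : ℂ) = 4 * (3 / (2 * π)) := by field_simp; norm_num
  have e3 : (12 / π : ℂ) = 8 * (3 / (2 * π)) := by field_simp; norm_num
  rw [e1, e2, e3] at this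
  linear_combination 9 / 55 * this + 32 / 11 * hr

lemma intervalIntegrable_beta {a b : ℝ} (ha : 0 < a) (hb : 0 < b) :
    IntervalIntegrable (fun t : ℝ ↦ t ^ (a - 1) * (1 - t) ^ (b - 1)) MeasureTheory.volume 0 1 := by
  have h := Complex.betaIntegral_convergent (u := a) (v := b) (by simpa) (by simpa)
  rw [intervalIntegrable_iff_integrableOn_Ioc_of_le zero_le_one] at h ⊢
  refine MeasureTheory.IntegrableOn.congr_fun h.re (fun t ht ↦ ?_) measurableSet_Ioc
  rw [← ofReal_one, ← ofReal_sub, ← ofReal_sub, ← ofReal_sub, ← ofReal_cpow ht.1.le,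
    ← ofReal_cpow (sub_nonneg.2 ht.2), ← ofReal_mul]
  exact ofReal_re _

lemma integral_beta {a b : ℝ} (ha : 0 < a) (hb : 0 < b) :
    ∫ t in (0 : ℝ)..1, t ^ (a - 1) * (1 - t) ^ (b - 1) =
      Real.Gamma a * Real.Gamma b / Real.Gamma (a + b) := by
  have h := Complex.betaIntegral_eq_Gamma_mul_div (a : ℂ) b (by simpa) (by simpa)
  rw [Complex.betaIntegral, ← ofReal_add, Complex.Gamma_ofReal, Complex.Gamma_ofReal,
    Complex.Gamma_ofReal] at h
  apply Complex.ofReal_injective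
  rw [← intervalIntegral.integral_ofReal]
  push_cast
  rw [← h]
  refine intervalIntegral.integral_congr fun t ht ↦ ?_
  rw [Set.uIcc_of_le zero_le_one] at ht
  rw [ofReal_cpow ht.1, ofReal_cpow (sub_nonneg.2 ht.2)]
  push_cast
  rfl

lemma two_mul_eq_integral {P P' : ℝ → ℝ} {k : ℝ} (hk : 0 < k)
    (hP : ∀ x ∈ Set.Ioo (0 : ℝ) 1, HasDerivAt P (P' x) x)
    (hP' : ∀ x ∈ Set.Ioo (0 : ℝ) 1, HasDerivAt P' (6 * P x ^ 2 - 2 * k ^ 4) x)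
    (hode : ∀ x ∈ Set.Ioo (0 : ℝ) 1, P' x ^ 2 = 4 * P x ^ 3 - 4 * k ^ 4 * P x)
    (hhalf : P' (1 / 2) = 0) (hzero : P 0 = 0) (htop : Tendsto P (𝓝[>] 0) atTop) :
    2 * k = ∫ t in (0 : ℝ)..1, t ^ ((1 / 4 : ℝ) - 1) * (1 - t) ^ ((1 / 2 : ℝ) - 1) := by
  have hk2 : 0 < k ^ 2 := by positivity
  have hge : ∀ x ∈ Set.Ioo (0 : ℝ) 1, k ^ 2 ≤ P x := by
    by_contra! h
    obtain ⟨x, hx, hPx⟩ := h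
    obtain ⟨y, hy1, hy⟩ := ((htop.eventually_ge_atTop (k ^ 2)).and
      (Ioo_mem_nhdsGT (show (0 : ℝ) < 1 by norm_num))).exists
    have hcont : ContinuousOn P (Set.Ioo 0 1) := fun z hz ↦
      (hP z hz).continuousAt.continuousWithinAt
    have hlt : max (P x) (k ^ 2 / 2) < k ^ 2 := max_lt hPx (by linarith)
    obtain ⟨z, hz, hPz⟩ := isPreconnected_Ioo.intermediate_value hx hy hcont
      (show (max (P x) (k ^ 2 / 2) + k ^ 2) / 2 ∈ Set.Icc (P x) (P y) from
        ⟨by linarith [le_max_left (P x) (k ^ 2 / 2)], by linarith⟩)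
    have h1 : 0 < P z := by linarith [le_max_right (P x) (k ^ 2 / 2)]
    have h2 : P z < k ^ 2 := by linarith
    have h3 := hode z hz
    have h4 : 0 < P z * ((k ^ 2 - P z) * (k ^ 2 + P z)) := by
      have := sub_pos.2 h2
      positivity
    nlinarith [sq_nonneg (P' z)]
  have hmono : StrictMonoOn P' (Set.Ioo 0 1) := by
    refine strictMonoOn_of_deriv_pos (convex_Ioo 0 1)
      (fun z hz ↦ (hP' z hz).continuousAt.continuousWithinAt) fun x hx ↦ ?_
    rw [interior_Ioo] at hx
    rw [(hP' x hx).deriv]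
    nlinarith [hge x hx]
  have hmem : ∀ x ∈ Set.Ioo (0 : ℝ) (1 / 2), x ∈ Set.Ioo (0 : ℝ) 1 := fun x hx ↦
    ⟨hx.1, by linarith [hx.2]⟩
  have hhalfmem : (1 / 2 : ℝ) ∈ Set.Ioo (0 : ℝ) 1 := by norm_num
  have hneg : ∀ x ∈ Set.Ioo (0 : ℝ) (1 / 2), P' x < 0 := fun x hx ↦
    hhalf ▸ hmono (hmem x hx) hhalfmem hx.2
  have hPhalf : P (1 / 2) = k ^ 2 := by
    have h1 := hode _ hhalfmem
    have h2 := hge _ hhalfmem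
    rw [hhalf] at h1
    have h3 : (P (1 / 2) - k ^ 2) * (P (1 / 2) * (P (1 / 2) + k ^ 2)) = 0 := by linarith
    have h4 : 0 < P (1 / 2) * (P (1 / 2) + k ^ 2) := by
      have : 0 < P (1 / 2) := by linarith
      positivity
    linarith [(mul_eq_zero.1 h3).resolve_right h4.ne']
  have hgt : ∀ x ∈ Set.Ioo (0 : ℝ) (1 / 2), k ^ 2 < P x := by
    intro x hx
    refine lt_of_le_of_ne (hge x (hmem x hx)) fun h ↦ (hneg x hx).ne ?_
    have h1 := hode x (hmem x hx)
    rw [← h] at h1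
    have : P' x ^ 2 = 0 := by rw [h1]; ring
    exact pow_eq_zero_iff two_ne_zero |>.1 this
  set r : ℝ → ℝ := fun x ↦ k ^ 4 / P x ^ 2 with hr
  set r' : ℝ → ℝ := fun x ↦ -2 * k ^ 4 * P' x / P x ^ 3 with hr'
  have hr_deriv : ∀ x ∈ Set.Ioo (0 : ℝ) 1, HasDerivAt r (r' x) x := by
    intro x hx
    have h0 : P x ≠ 0 := by linarith [hge x hx]
    have := (hasDerivAt_const x (k ^ 4)).div ((hP x hx).pow 2) (pow_ne_zero 2 h0)
    refine this.congr_deriv ?_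
    simp only [hr', Pi.pow_apply]
    field_simp
    ring
  have hr_mem : ∀ x ∈ Set.Ioo (0 : ℝ) (1 / 2), r x ∈ Set.Ioo (0 : ℝ) 1 := by
    intro x hx
    have h0 : 0 < P x := by linarith [hgt x hx]
    refine ⟨by positivity, (div_lt_one (by positivity)).2 ?_⟩
    nlinarith [hgt x hx]
  have hr0 : r 0 = 0 := by simp [hr, hzero]
  have hr1 : r (1 / 2) = 1 := by
    simp only [hr, hPhalf]
    field_simp
  have hr_cont : ContinuousOn r (Set.Icc 0 (1 / 2)) := by
    intro x hx
    rcases hx.1.eq_or_lt with rfl | h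
    · have h1 : Tendsto r (𝓝[>] 0) (𝓝 (r 0)) := by
        rw [hr0]
        exact ((tendsto_pow_atTop two_ne_zero).comp htop).const_div_atTop (k ^ 4)
      exact (continuousWithinAt_Ioi_iff_Ici.1 h1).mono Set.Icc_subset_Ici_self
    · exact (hr_deriv x ⟨h, by linarith [hx.2]⟩).continuousAt.continuousWithinAt
  set g : ℝ → ℝ := fun t ↦ t ^ ((1 / 4 : ℝ) - 1) * (1 - t) ^ ((1 / 2 : ℝ) - 1) with hg
  have hprod : ∀ x ∈ Set.Ioo (0 : ℝ) (1 / 2), (g ∘ r) x * r' x = 4 * k := by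
    intro x hx
    have h0 : 0 < P x := by linarith [hgt x hx]
    obtain ⟨hr2, hr3⟩ := hr_mem x hx
    have hode' := hode x (hmem x hx)
    set s := √(P x) with hs
    have hs0 : 0 < s := Real.sqrt_pos.2 h0
    have hPs : P x = s ^ 2 := (Real.sq_sqrt h0.le).symm
    have hrs : r x = (k / s) ^ 4 := by
      simp only [hr, hPs]
      field_simp
    set u := √(1 - r x) with hu
    have hu0 : 0 < u := Real.sqrt_pos.2 (by linarith)
    have hu2 : u ^ 2 = 1 - r x := Real.sq_sqrt (by linarith)
    have h1 : r x ^ ((1 / 4 : ℝ) - 1) = (s / k) ^ 3 := by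
      rw [hrs, ← Real.rpow_natCast (k / s), ← Real.rpow_mul (by positivity)]
      norm_num
      rw [← inv_pow, inv_div]
    have h2 : (1 - r x) ^ ((1 / 2 : ℝ) - 1) = u⁻¹ := by
      rw [show (1 / 2 : ℝ) - 1 = -(1 / 2) by norm_num, Real.rpow_neg (by linarith), hu,
        Real.sqrt_eq_rpow]
    have h3 : P' x = -2 * s ^ 3 * u := by
      have : (P' x) ^ 2 = (2 * s ^ 3 * u) ^ 2 := by
        rw [hode', mul_pow, hu2, hrs, hPs]
        field_simp
        ring
      rcases sq_eq_sq_iff_eq_or_eq_neg.1 this with h | h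
      · have : 0 < 2 * s ^ 3 * u := by positivity
        linarith [hneg x hx]
      · linarith
    simp only [Function.comp, hg, hr']
    rw [h1, h2, h3, hPs]
    field_simp
    ring
  have hle : (0 : ℝ) ≤ 1 / 2 := by norm_num
  have key := intervalIntegral.integral_comp_mul_deriv''' (a := 0) (b := 1 / 2) (f := r) (f' := r')
    (g := g) (by rwa [Set.uIcc_of_le hle])
    (fun x hx ↦ by
      rw [min_eq_left hle, max_eq_right hle] at hx
      exact (hr_deriv x (hmem x hx)).hasDerivWithinAt)
    (by
      rw [min_eq_left hle, max_eq_right hle]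
      rintro t ⟨x, hx, rfl⟩
      obtain ⟨h1, h2⟩ := hr_mem x hx
      refine ContinuousAt.continuousWithinAt ?_
      refine (Real.continuousAt_rpow_const _ _ (.inl h1.ne')).mul ?_
      exact ContinuousAt.rpow_const (by fun_prop) (.inl (by linarith)))
    (by
      rw [Set.uIcc_of_le hle]
      have h := intervalIntegrable_beta (a := 1 / 4) (b := 1 / 2) (by norm_num) (by norm_num)
      rw [intervalIntegrable_iff_integrableOn_Icc_of_le zero_le_one] at h
      refine h.mono_set ?_
      rintro t ⟨x, hx, rfl⟩
      rcases hx.1.eq_or_lt with rfl | h1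
      · rw [hr0]
        norm_num
      rcases hx.2.eq_or_lt with rfl | h2
      · rw [hr1]
        norm_num
      exact Set.Ioo_subset_Icc_self (hr_mem x ⟨h1, h2⟩))
    (by
      rw [Set.uIcc_of_le hle, integrableOn_Icc_iff_integrableOn_Ioo]
      refine (MeasureTheory.integrableOn_const (C := 4 * k) (by simp)).congr_fun
        (fun x hx ↦ (hprod x hx).symm) measurableSet_Ioo)
  rw [hr0, hr1] at key
  rw [← key, intervalIntegral.integral_of_le hle, MeasureTheory.integral_Ioc_eq_integral_Ioo,
    MeasureTheory.setIntegral_congr_fun measurableSet_Ioo hprod]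
  simp
  ring

lemma integral_beta_quarter_half :
    ∫ t in (0 : ℝ)..1, t ^ ((1 / 4 : ℝ) - 1) * (1 - t) ^ ((1 / 2 : ℝ) - 1) =
      Real.Gamma (1 / 4) ^ 2 / √(2 * π) := by
  rw [integral_beta (by norm_num) (by norm_num), Real.Gamma_one_half_eq]
  have h := Real.Gamma_mul_Gamma_one_sub (1 / 4)
  rw [show π * (1 / 4) = π / 4 by ring, Real.sin_pi_div_four] at h
  norm_num at h ⊢
  have h1 : 0 < Real.Gamma (3 / 4) := Real.Gamma_pos_of_pos (by norm_num)
  have h2 : 0 < √π := Real.sqrt_pos.2 Real.pi_pos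
  have h3 : (√2) ^ 2 = 2 := Real.sq_sqrt (by norm_num)
  have h4 : √π ^ 2 = π := Real.sq_sqrt Real.pi_pos.le
  have h5 : 0 < √2 := by positivity
  field_simp at h ⊢
  refine mul_right_cancel₀ h5.ne' ?_
  linear_combination √π ^ 2 * h3 + 2 * h4 - h

section Lemniscate

open scoped PeriodPair ComplexConjugate

/-- The period pair spanning the Gaussian integers. -/
noncomputable def gaussianPair : PeriodPair where
  ω₁ := 1
  ω₂ := I
  indep := by
    rw [LinearIndependent.pair_iff]
    intro s t h
    have h1 := congrArg Complex.re h
    have h2 := congrArg Complex.im h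
    simp at h1 h2
    exact ⟨h1, h2⟩

@[simp] lemma gaussianPair_ω₁ : gaussianPair.ω₁ = 1 := rfl

@[simp] lemma gaussianPair_ω₂ : gaussianPair.ω₂ = I := rfl

lemma mem_gaussianPair_lattice {z : ℂ} :
    z ∈ gaussianPair.lattice ↔ ∃ m n : ℤ, (m : ℂ) + n * I = z := by
  rw [PeriodPair.mem_lattice]
  simp

lemma notMem_gaussianPair_lattice {z : ℂ} (h0 : 0 < z.re) (h1 : z.re < 1) :
    z ∉ gaussianPair.lattice := by
  rw [mem_gaussianPair_lattice]
  rintro ⟨m, n, rfl⟩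
  simp at h0 h1
  norm_cast at h0 h1
  omega

/-- Complex conjugation on the Gaussian lattice. -/
noncomputable def conjLattice : gaussianPair.lattice ≃ gaussianPair.lattice where
  toFun l := ⟨conj l.1, by
    obtain ⟨m, n, h⟩ := mem_gaussianPair_lattice.1 l.2
    exact mem_gaussianPair_lattice.2 ⟨m, -n, by simp [← h]⟩⟩
  invFun l := ⟨conj l.1, by
    obtain ⟨m, n, h⟩ := mem_gaussianPair_lattice.1 l.2
    exact mem_gaussianPair_lattice.2 ⟨m, -n, by simp [← h]⟩⟩
  left_inv l := by simp
  right_inv l := by simp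

@[simp] lemma coe_conjLattice (l : gaussianPair.lattice) : (conjLattice l : ℂ) = conj (l : ℂ) := rfl

lemma weierstrassP_ofReal (x : ℝ) : (((℘[gaussianPair] x).re : ℝ) : ℂ) = ℘[gaussianPair] x := by
  rw [← conj_eq_iff_re, PeriodPair.weierstrassP, conj_tsum, ← conjLattice.tsum_eq]
  simp

lemma derivWeierstrassP_ofReal (x : ℝ) :
    (((℘'[gaussianPair] x).re : ℝ) : ℂ) = ℘'[gaussianPair] x := by
  rw [← conj_eq_iff_re, PeriodPair.derivWeierstrassP, map_neg, conj_tsum, ← conjLattice.tsum_eq]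
  simp [map_ofNat]

lemma derivWeierstrassP_half : ℘'[gaussianPair] (1 / 2 : ℂ) = 0 := by
  have h := gaussianPair.derivWeierstrassP_add_coe (-(1 / 2))
    ⟨1, mem_gaussianPair_lattice.2 ⟨1, 0, by simp⟩⟩
  rw [gaussianPair.derivWeierstrassP_neg] at h
  norm_num at h
  rw [← self_eq_neg]
  exact h

lemma tendsto_weierstrassP_zero :
    Tendsto (fun x : ℝ ↦ (℘[gaussianPair] x).re) (𝓝[>] 0) atTop := by
  have h1 : ∀ x : ℝ, (℘[gaussianPair] x).re =
      (gaussianPair.weierstrassPExcept 0 x).re + (x ^ 2)⁻¹ := by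
    intro x
    have := gaussianPair.weierstrassPExcept_add 0 x
    simp only [ZeroMemClass.coe_zero, sub_zero] at this
    rw [← this, add_re, zero_pow two_ne_zero, div_zero, sub_zero, one_div, ← ofReal_pow,
      ← ofReal_inv, ofReal_re]
  simp_rw [h1]
  refine Tendsto.add_atTop (C := (gaussianPair.weierstrassPExcept 0 (0 : ℝ)).re) ?_ ?_
  · have : ContinuousAt (gaussianPair.weierstrassPExcept 0) ((0 : ℝ) : ℂ) := by
      simpa using (gaussianPair.analyticAt_weierstrassPExcept 0).continuousAt
    exact (Complex.continuous_re.continuousAt.comp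
      (this.comp (f := ((↑) : ℝ → ℂ)) continuous_ofReal.continuousAt)).tendsto.mono_left
        nhdsWithin_le_nhds
  · refine Tendsto.inv_tendsto_nhdsGT_zero (tendsto_nhdsWithin_iff.2 ⟨?_, ?_⟩)
    · have : Tendsto (fun x : ℝ ↦ x ^ 2) (𝓝 0) (𝓝 (0 ^ 2)) := (continuous_pow 2).tendsto 0
      rw [zero_pow two_ne_zero] at this
      exact this.mono_left nhdsWithin_le_nhds
    · filter_upwards [self_mem_nhdsWithin] with x hx
      exact pow_pos (Set.mem_Ioi.1 hx) 2

lemma hasDerivAt_weierstrassP (L : PeriodPair) {z : ℂ} (hz : z ∉ L.lattice) :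
    HasDerivAt ℘[L] (℘'[L] z) z := by
  rw [← L.deriv_weierstrassP]
  exact (L.analyticOnNhd_weierstrassP z hz).differentiableAt.hasDerivAt

lemma G_eq {k : ℕ} (hk : 3 ≤ k) :
    gaussianPair.G k = 2 * riemannZeta k * ModularForm.E hk ptI := by
  have h1 : ModularForm.E hk ptI = 1 / 2 * eisensteinSeries (N := 1) 0 k ptI := rfl
  have h2 := tsum_eisSummand_eq_riemannZeta_mul_eisensteinSeries hk ptI
  rw [h1, show 2 * riemannZeta k * (1 / 2 * eisensteinSeries (N := 1) 0 k ptI) =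
    riemannZeta k * eisensteinSeries (N := 1) 0 k ptI by ring, ← h2, PeriodPair.G,
    ← gaussianPair.latticeEquivProd.symm.toEquiv.tsum_eq,
    ← ((finTwoArrowEquiv ℤ).trans (Equiv.prodComm ℤ ℤ)).tsum_eq]
  refine tsum_congr fun v ↦ ?_
  change (((gaussianPair.latticeEquivProd.symm (v 1, v 0) : gaussianPair.lattice) : ℂ) ^ k)⁻¹ = _
  simp [eisSummand, PeriodPair.latticeEquiv_symm_apply, add_comm]

lemma g₂_eq : gaussianPair.g₂ = 4 * π ^ 4 / 3 * E₄ ptI := by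
  rw [PeriodPair.g₂, G_eq (by norm_num)]
  push_cast
  rw [riemannZeta_four]
  ring

lemma g₃_eq : gaussianPair.g₃ = 0 := by
  rw [PeriodPair.g₃, G_eq (by norm_num), E₆_I]
  ring

lemma hasDerivAt_derivWeierstrassP {x : ℝ} (hx : x ∈ Set.Ioo (0 : ℝ) 1) :
    HasDerivAt ℘'[gaussianPair] (6 * ℘[gaussianPair] x ^ 2 - gaussianPair.g₂ / 2) x := by
  set L := gaussianPair
  set U : Set ℂ := Complex.re ⁻¹' Set.Ioo 0 1 with hU
  have hUo : IsOpen U := isOpen_Ioo.preimage Complex.continuous_re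
  have hUc : IsPreconnected U :=
    ((convex_Ioo (0 : ℝ) 1).linear_preimage Complex.reLm).isPreconnected
  have hUL : ∀ z ∈ U, z ∉ L.lattice := fun z hz ↦ notMem_gaussianPair_lattice hz.1 hz.2
  have hxU : ∀ y ∈ Set.Ioo (0 : ℝ) 1, (y : ℂ) ∈ U := fun y hy ↦ hy
  have hd : ∀ z ∈ U, HasDerivAt ℘'[L] (deriv ℘'[L] z) z := fun z hz ↦
    (L.analyticOnNhd_derivWeierstrassP z (hUL z hz)).differentiableAt.hasDerivAt
  have hode : ∀ z ∈ U, ℘'[L] z * (2 * deriv ℘'[L] z - 12 * ℘[L] z ^ 2 + L.g₂) = 0 := by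
    intro z hz
    have h1 := (hd z hz).pow 2
    have h2 := (((hasDerivAt_weierstrassP L (hUL z hz)).pow 3).const_mul 4).sub
      ((hasDerivAt_weierstrassP L (hUL z hz)).const_mul L.g₂)
    have h3 := h1.unique ((h2.sub_const L.g₃).congr_of_eventuallyEq (by
      filter_upwards [hUo.mem_nhds hz] with w hw
      simpa using L.derivWeierstrassP_sq w (hUL w hw)))
    push_cast at h3
    linear_combination h3
  have hne : ∀ᶠ z in 𝓝[≠] (x : ℂ), ℘'[L] z ≠ 0 := by
    have hA : AnalyticOnNhd ℂ ℘'[L] U := L.analyticOnNhd_derivWeierstrassP.mono hUL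
    refine (hA x (hxU x hx)).eventually_eq_zero_or_eventually_ne_zero.resolve_left fun h ↦ ?_
    have h0 := hA.eqOn_zero_of_preconnected_of_eventuallyEq_zero hUc (hxU x hx) h
    obtain ⟨y, hy, hy'⟩ := ((tendsto_weierstrassP_zero.eventually_ge_atTop
      ((℘[L] x).re + 1)).and (Ioo_mem_nhdsGT (show (0 : ℝ) < 1 by norm_num))).exists
    have : ℘[L] y = ℘[L] x := hUo.is_const_of_deriv_eq_zero hUc
      (L.analyticOnNhd_weierstrassP.mono hUL).differentiableOn
      (by rwa [L.deriv_weierstrassP]) (hxU y hy') (hxU x hx)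
    rw [this] at hy
    linarith
  have hcont : ContinuousAt (fun z ↦ 2 * deriv ℘'[L] z - 12 * ℘[L] z ^ 2 + L.g₂) (x : ℂ) := by
    have h1 := (L.analyticOnNhd_derivWeierstrassP x (hUL x (hxU x hx))).deriv.continuousAt
    have h2 := (L.analyticOnNhd_weierstrassP x (hUL x (hxU x hx))).continuousAt
    fun_prop
  have hzero : 2 * deriv ℘'[L] x - 12 * ℘[L] x ^ 2 + L.g₂ = 0 := by
    refine tendsto_nhds_unique (l := 𝓝[≠] (x : ℂ)) (hcont.tendsto.mono_left nhdsWithin_le_nhds)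
      (tendsto_const_nhds.congr' (f₁ := fun _ ↦ 0) ?_)
    filter_upwards [hne, mem_nhdsWithin_of_mem_nhds (hUo.mem_nhds (hxU x hx))] with z hz hzU
    exact ((mul_eq_zero.1 (hode z hzU)).resolve_left hz).symm
  convert! hd x (hxU x hx) using 1
  linear_combination -hzero / 2

/-- The value of `E₄` at `I`. -/
lemma E₄_I : E₄ ptI = ((3 * Real.Gamma (1 / 4) ^ 8 / (64 * π ^ 6) : ℝ) : ℂ) := by
  obtain ⟨e, he0, he⟩ := exists_E₄_I
  obtain ⟨k, hk, hk4⟩ : ∃ k : ℝ, 0 < k ∧ k ^ 4 = π ^ 4 / 3 * e := by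
    have : 0 < π ^ 4 / 3 * e := by positivity
    refine ⟨√√(π ^ 4 / 3 * e), by positivity, ?_⟩
    rw [show 4 = 2 * 2 from rfl, pow_mul, Real.sq_sqrt (by positivity), Real.sq_sqrt this.le]
  have hg₂ : gaussianPair.g₂ = ((4 * k ^ 4 : ℝ) : ℂ) := by
    rw [g₂_eq, he, hk4]
    push_cast
    ring
  have hnot : ∀ x ∈ Set.Ioo (0 : ℝ) 1, (x : ℂ) ∉ gaussianPair.lattice := fun x hx ↦
    notMem_gaussianPair_lattice hx.1 hx.2
  have key := two_mul_eq_integral (P := fun x ↦ (℘[gaussianPair] x).re)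
    (P' := fun x ↦ (℘'[gaussianPair] x).re) hk
    (fun x hx ↦ (hasDerivAt_weierstrassP gaussianPair (hnot x hx)).real_of_complex)
    (fun x hx ↦ (hasDerivAt_derivWeierstrassP hx).real_of_complex.congr_deriv (by
      rw [← weierstrassP_ofReal, hg₂]
      norm_cast
      simp
      ring))
    (fun x hx ↦ by
      have := gaussianPair.derivWeierstrassP_sq x (hnot x hx)
      rw [← weierstrassP_ofReal, ← derivWeierstrassP_ofReal, hg₂, g₃_eq] at this
      norm_cast at this
      simpa using this)
    (by
      have := derivWeierstrassP_half
      push_cast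
      rw [this, Complex.zero_re])
    (by simp) tendsto_weierstrassP_zero
  rw [integral_beta_quarter_half] at key
  have h1 : (2 * k) ^ 4 = Real.Gamma (1 / 4) ^ 8 / (4 * π ^ 2) := by
    have : (√(2 * π)) ^ 4 = 4 * π ^ 2 := by
      rw [show 4 = 2 * 2 from rfl, pow_mul, Real.sq_sqrt (by positivity)]
      ring
    rw [key, div_pow, this]
    ring
  have h2 : e = 3 * Real.Gamma (1 / 4) ^ 8 / (64 * π ^ 6) := by
    rw [mul_pow, hk4] at h1
    have := Real.pi_pos
    field_simp at h1 ⊢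
    linarith
  rw [he, h2]

end Lemniscate

/-- The odd Dirichlet character modulo `4` as a real-valued function on `ℕ`. -/
noncomputable def chi (n : ℕ) : ℝ := (ZMod.χ₄ n : ℤ)

lemma chi_mul (m n : ℕ) : chi (m * n) = chi m * chi n := by
  simp only [chi, Nat.cast_mul, map_mul, Int.cast_mul]

lemma chi_two_mul (n : ℕ) : chi (2 * n) = 0 := by
  rw [chi, ZMod.χ₄_nat_eq_if_mod_four]
  simp

lemma chi_two_mul_add_one (n : ℕ) : chi (2 * n + 1) = (-1) ^ n := by
  rw [chi, ZMod.χ₄_eq_neg_one_pow (by omega), show (2 * n + 1) / 2 = n by omega]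
  push_cast
  rfl

lemma abs_chi_le_one (n : ℕ) : |chi n| ≤ 1 := by
  obtain ⟨k, rfl | rfl⟩ := n.even_or_odd'
  · simp [chi_two_mul]
  · simp [chi_two_mul_add_one]

lemma hasSum_chi_mul_iff {F : ℕ → ℝ} {a : ℝ} :
    HasSum (fun n : ℕ ↦ chi n * F n) a ↔ HasSum (fun n : ℕ ↦ (-1) ^ n * F (2 * n + 1)) a := by
  have hinj : Function.Injective fun n : ℕ ↦ 2 * n + 1 := fun m n h ↦ by simpa using h
  rw [← hinj.hasSum_iff (f := fun n : ℕ ↦ chi n * F n)]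
  · simp only [Function.comp_def, chi_two_mul_add_one]
  · intro n hn
    obtain ⟨k, rfl | rfl⟩ := n.even_or_odd'
    · simp [chi_two_mul]
    · exact absurd ⟨k, rfl⟩ hn

lemma hasSum_pnat_iff {F : ℕ → ℝ} {a : ℝ} (h : F 0 = 0) :
    HasSum (fun n : ℕ+ ↦ F n) a ↔ HasSum F a := by
  refine PNat.coe_injective.hasSum_iff fun n hn ↦ ?_
  rcases n.eq_zero_or_pos with rfl | hn'
  · exact h
  · exact absurd ⟨⟨n, hn'⟩, rfl⟩ hn

lemma hasSum_inv_cosh_cubed {y : ℝ} (hy : 0 < y) :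
    HasSum (fun n : ℕ ↦ chi n * ((1 - n ^ 2) * Real.exp (-y) ^ n)) (1 / Real.cosh y ^ 3) := by
  set x := Real.exp (-y) with hx
  have hx0 : 0 < x := Real.exp_pos _
  have hx1 : x < 1 := Real.exp_lt_one_iff.2 (by linarith)
  have hcosh : Real.cosh y = (1 + x ^ 2) / (2 * x) := by
    have : Real.exp y = x⁻¹ := by rw [hx, Real.exp_neg, inv_inv]
    rw [Real.cosh_eq, this, ← hx]
    field_simp
  have h1 := (hasSum_choose_mul_geometric_of_norm_lt_one (r := -x ^ 2) 2
    (by rw [norm_neg, Real.norm_of_nonneg (by positivity)]; nlinarith)).mul_left (8 * x ^ 3)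
  rw [hasSum_chi_mul_iff]
  set f : ℕ → ℝ := fun n ↦ (-1) ^ n * ((1 - ((2 * n + 1 : ℕ) : ℝ) ^ 2) * x ^ (2 * n + 1)) with hf
  have h2 : HasSum (fun n ↦ f (n + 1)) (1 / Real.cosh y ^ 3) := by
    convert! h1 using 1
    · ext n
      rw [hf, Nat.cast_choose_two, neg_pow (x ^ 2), ← pow_mul]
      push_cast
      ring
    · rw [hcosh]
      field_simp
      ring
  simpa [hf] using (hasSum_nat_add_iff 1).1 h2

lemma norm_chi_mul_chi_le {r : ℝ} (hr0 : 0 < r) (hr1 : r < 1) {m n : ℕ} (hm : 1 ≤ m)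
    (hn : 1 ≤ n) :
    ‖chi m * chi n * ((m : ℝ) ^ 7 * (1 - (n : ℝ) ^ 2) * r ^ (m * n))‖ ≤
      (m : ℝ) ^ 7 * √r ^ m * ((n : ℝ) ^ 7 * √r ^ n) := by
  have hs1 : √r ≤ 1 := Real.sqrt_le_one.2 hr1.le
  have hn' : (1 : ℝ) ≤ n := by exact_mod_cast hn
  have h1 : |1 - (n : ℝ) ^ 2| ≤ (n : ℝ) ^ 7 := by
    rw [abs_sub_comm, abs_of_nonneg (by nlinarith)]
    have : (n : ℝ) ^ 2 ≤ (n : ℝ) ^ 7 := pow_le_pow_right₀ hn' (by norm_num)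
    linarith
  have h2 : r ^ (m * n) ≤ √r ^ m * √r ^ n := by
    have h3 : m + n ≤ 2 * (m * n) := by nlinarith
    calc
      r ^ (m * n) = √r ^ (2 * (m * n)) := by
          rw [pow_mul √r, Real.sq_sqrt hr0.le]
      _ ≤ √r ^ (m + n) := pow_le_pow_of_le_one (Real.sqrt_nonneg _) hs1 h3
      _ = _ := pow_add _ _ _
  have h4 : |chi m * chi n| ≤ 1 := by
    rw [← chi_mul]
    exact abs_chi_le_one _
  rw [norm_mul, norm_mul ((m : ℝ) ^ 7 * _), norm_mul ((m : ℝ) ^ 7)]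
  simp only [Real.norm_eq_abs]
  rw [abs_of_nonneg (show (0 : ℝ) ≤ (m : ℝ) ^ 7 by positivity),
    abs_of_nonneg (show 0 ≤ r ^ (m * n) by positivity)]
  calc |chi m * chi n| * ((m : ℝ) ^ 7 * |1 - (n : ℝ) ^ 2| * r ^ (m * n))
      ≤ 1 * ((m : ℝ) ^ 7 * (n : ℝ) ^ 7 * (√r ^ m * √r ^ n)) := by gcongr
    _ = _ := by ring

lemma summable_chi {r : ℝ} (hr0 : 0 < r) (hr1 : r < 1) :
    Summable fun p : ℕ+ × ℕ+ ↦ chi p.1 * chi p.2 *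
      ((p.1 : ℝ) ^ 7 * (1 - (p.2 : ℝ) ^ 2) * r ^ (p.1 * p.2 : ℕ)) := by
  have hs1 : ‖√r‖ < 1 := by
    rwa [Real.norm_of_nonneg (Real.sqrt_nonneg r), Real.sqrt_lt' one_pos, one_pow]
  have h0 : Summable fun n : ℕ ↦ (n : ℝ) ^ 7 * √r ^ n :=
    summable_pow_mul_geometric_of_norm_lt_one 7 hs1
  have h : Summable fun n : ℕ+ ↦ (n : ℝ) ^ 7 * √r ^ (n : ℕ) :=
    h0.comp_injective PNat.coe_injective
  have h2 : Summable fun p : ℕ+ × ℕ+ ↦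
      (p.1 : ℝ) ^ 7 * √r ^ (p.1 : ℕ) * ((p.2 : ℝ) ^ 7 * √r ^ (p.2 : ℕ)) :=
    h.mul_of_nonneg h (fun n ↦ by positivity) (fun n ↦ by positivity)
  exact Summable.of_norm_bounded h2 fun p ↦
    norm_chi_mul_chi_le hr0 hr1 p.1.pos p.2.pos

lemma sum_divisorsAntidiagonal_chi (n : ℕ) (r : ℝ) :
    ∑ p ∈ n.divisorsAntidiagonal, chi p.1 * chi p.2 *
      ((p.1 : ℝ) ^ 7 * (1 - (p.2 : ℝ) ^ 2) * r ^ (p.1 * p.2 : ℕ)) =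
      chi n * ((σ 7 n - n ^ 2 * σ 5 n) * r ^ n) := by
  have h : ∀ p ∈ n.divisorsAntidiagonal, chi p.1 * chi p.2 *
      ((p.1 : ℝ) ^ 7 * (1 - (p.2 : ℝ) ^ 2) * r ^ (p.1 * p.2 : ℕ)) =
      chi n * (((p.1 : ℝ) ^ 7 - n ^ 2 * (p.1 : ℝ) ^ 5) * r ^ n) := by
    intro p hp
    rw [← (Nat.mem_divisorsAntidiagonal.1 hp).1, chi_mul]
    push_cast
    ring
  rw [Finset.sum_congr rfl h, Nat.sum_divisorsAntidiagonal
    (f := fun d _ ↦ chi n * (((d : ℝ) ^ 7 - n ^ 2 * (d : ℝ) ^ 5) * r ^ n)),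
    ← Finset.mul_sum, ← Finset.sum_mul, Finset.sum_sub_distrib, ← Finset.mul_sum,
    ArithmeticFunction.sigma_apply, ArithmeticFunction.sigma_apply]
  push_cast
  rfl

lemma hasSum_div_cosh_cubed {S : ℝ}
    (h : HasSum (fun n : ℕ ↦ chi n * ((σ 7 n - n ^ 2 * σ 5 n) * Real.exp (-(π / 2)) ^ n)) S) :
    HasSum (fun n : ℕ ↦ (-1) ^ n * (2 * (n : ℝ) + 1) ^ 7 /
      Real.cosh ((2 * (n : ℝ) + 1) * π / 2) ^ 3) S := by
  have hs := (summable_chi (Real.exp_pos (-(π / 2)))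
    (Real.exp_lt_one_iff.2 (by linarith [Real.pi_pos]))).hasSum
  have h1 := (sigmaAntidiagonalEquivProd.hasSum_iff.2 hs).sigma fun n ↦ hasSum_fintype _
  have h2 := hs.prod_fiberwise (g := fun m : ℕ+ ↦ chi m * (m ^ 7 / Real.cosh (m * π / 2) ^ 3))
    fun m ↦ by
      have hm : (0 : ℝ) < m * π / 2 := by positivity
      have := ((hasSum_pnat_iff (by simp [chi])).2 (hasSum_inv_cosh_cubed hm)).mul_left
        (chi m * (m : ℝ) ^ 7)
      convert! this using 1
      · ext n
        rw [pow_mul, ← Real.exp_nat_mul (-(π / 2)), show (m : ℕ) * -(π / 2) = -(m * π / 2) by ring]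
        ring
      · ring
  rw [hasSum_pnat_iff (F := fun m ↦ chi m * (m ^ 7 / Real.cosh (m * π / 2) ^ 3)) (by simp [chi]),
    hasSum_chi_mul_iff] at h2
  rw [← hasSum_pnat_iff (by simp [chi])] at h
  have h3 : ∀ n : ℕ+, ∑ p : (n : ℕ).divisorsAntidiagonal,
      ((fun p : ℕ+ × ℕ+ ↦ chi p.1 * chi p.2 * ((p.1 : ℝ) ^ 7 * (1 - (p.2 : ℝ) ^ 2) *
        Real.exp (-(π / 2)) ^ (p.1 * p.2 : ℕ))) ∘ sigmaAntidiagonalEquivProd) ⟨n, p⟩ =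
      chi n * ((σ 7 n - n ^ 2 * σ 5 n) * Real.exp (-(π / 2)) ^ (n : ℕ)) := by
    intro n
    rw [← sum_divisorsAntidiagonal_chi]
    exact Finset.sum_coe_sort (n : ℕ).divisorsAntidiagonal fun p : ℕ × ℕ ↦ chi p.1 * chi p.2 *
      ((p.1 : ℝ) ^ 7 * (1 - (p.2 : ℝ) ^ 2) * Real.exp (-(π / 2)) ^ (p.1 * p.2))
  simp_rw [h3] at h1
  rw [h.unique h1]
  convert! h2 using 2 with n
  push_cast
  ring

/-- The point `(1 + i) / 4`. -/
noncomputable def ptRight : ℍ := pt (1 / 4) (1 / 4) (by norm_num)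

/-- The point `(-1 + i) / 4`. -/
noncomputable def ptLeft : ℍ := pt (-(1 / 4)) (1 / 4) (by norm_num)

lemma coe_ptRight : (ptRight : ℂ) = (1 + I) / 4 := by
  rw [ptRight, coe_pt]
  push_cast
  ring

lemma coe_ptLeft : (ptLeft : ℂ) = (-1 + I) / 4 := by
  rw [ptLeft, coe_pt]
  push_cast
  ring

lemma ptRight_mul : (ptRight : ℂ) * (((1 : ℤ) : ℂ) * ptTwoI + ((-2 : ℤ) : ℂ)) =
    ((0 : ℤ) : ℂ) * ptTwoI + ((-1 : ℤ) : ℂ) := by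
  rw [coe_ptRight, coe_ptTwoI]
  push_cast
  linear_combination I_sq / 2

lemma ptLeft_mul : (ptLeft : ℂ) * (((1 : ℤ) : ℂ) * ptTwoI + ((2 : ℤ) : ℂ)) =
    ((0 : ℤ) : ℂ) * ptTwoI + ((-1 : ℤ) : ℂ) := by
  rw [coe_ptLeft, coe_ptTwoI]
  push_cast
  linear_combination I_sq / 2

lemma E₄_ptRight : E₄ ptRight = -64 * E₄ ptTwoI := by
  rw [modular_apply E₄ 0 (-1) 1 (-2) (by norm_num) ptRight_mul, coe_ptTwoI, zpow_ofNat]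
  push_cast
  linear_combination (16 * I ^ 2 - 64 * I + 80) * E₄ ptTwoI * I_sq

lemma E₄_ptLeft : E₄ ptLeft = -64 * E₄ ptTwoI := by
  rw [modular_apply E₄ 0 (-1) 1 2 (by norm_num) ptLeft_mul, coe_ptTwoI, zpow_ofNat]
  push_cast
  linear_combination (16 * I ^ 2 + 64 * I + 80) * E₄ ptTwoI * I_sq

lemma E₆_ptRight : E₆ ptRight = 512 * I * E₆ ptTwoI := by
  rw [modular_apply E₆ 0 (-1) 1 (-2) (by norm_num) ptRight_mul, coe_ptTwoI, zpow_ofNat]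
  push_cast
  rw [show (1 * (2 * I) + -2 : ℂ) ^ 6 = 512 * I by
    linear_combination (64 * I ^ 4 - 384 * I ^ 3 + 896 * I ^ 2 - 896 * I + 64) * I_sq]

lemma E₆_ptLeft : E₆ ptLeft = -512 * I * E₆ ptTwoI := by
  rw [modular_apply E₆ 0 (-1) 1 2 (by norm_num) ptLeft_mul, coe_ptTwoI, zpow_ofNat]
  push_cast
  rw [show (1 * (2 * I) + 2 : ℂ) ^ 6 = -512 * I by
    linear_combination (64 * I ^ 4 + 384 * I ^ 3 + 896 * I ^ 2 + 896 * I + 64) * I_sq]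

lemma E2_ptRight : E2 ptRight = -8 * I * (E2 ptTwoI - 3 / (2 * π)) + 12 / π := by
  rw [E2_apply 0 (-1) 1 (-2) (by norm_num) ptRight_mul, coe_ptTwoI]
  push_cast
  have h := ofReal_pi_ne_zero'
  field_simp
  ring_nf
  simp only [I_sq, I_pow_three]
  ring

lemma E2_ptLeft : E2 ptLeft = 8 * I * (E2 ptTwoI - 3 / (2 * π)) + 12 / π := by
  rw [E2_apply 0 (-1) 1 2 (by norm_num) ptLeft_mul, coe_ptTwoI]
  push_cast
  have h := ofReal_pi_ne_zero'
  field_simp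
  ring_nf
  simp only [I_sq, I_pow_three]
  ring

lemma ofReal_chi (n : ℕ) : (chi n : ℂ) = (I ^ n - (-I) ^ n) / (2 * I) := by
  obtain ⟨k, rfl | rfl⟩ := n.even_or_odd'
  · simp [chi_two_mul, pow_mul]
  · rw [chi_two_mul_add_one]
    rw [pow_succ, pow_succ, pow_mul, pow_mul, neg_sq, I_sq]
    push_cast
    field_simp
    ring

lemma cexp_ptRight : cexp (2 * π * I * ptRight) = I * Real.exp (-(π / 2)) := by
  rw [coe_ptRight, show (2 * π * I * ((1 + I) / 4) : ℂ) = π / 2 * I + ((-(π / 2) : ℝ) : ℂ) by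
    push_cast; linear_combination π / 2 * I_sq, Complex.exp_add, Complex.exp_pi_div_two_mul_I,
    ofReal_exp]

lemma cexp_ptLeft : cexp (2 * π * I * ptLeft) = -I * Real.exp (-(π / 2)) := by
  rw [coe_ptLeft, show (2 * π * I * ((-1 + I) / 4) : ℂ) = -π / 2 * I + ((-(π / 2) : ℝ) : ℂ) by
    push_cast; linear_combination π / 2 * I_sq, Complex.exp_add, Complex.exp_neg_pi_div_two_mul_I,
    ofReal_exp]

lemma HasQExp.hasSum_chi {F : ℍ → ℂ} {c : ℕ → ℂ} (h : HasQExp F c) :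
    HasSum (fun n ↦ chi n * (c n * Real.exp (-(π / 2)) ^ n))
      ((F ptRight - F ptLeft) / (2 * I)) := by
  convert! ((h ptRight).sub (h ptLeft)).div_const (2 * I) using 2 with n
  rw [cexp_ptRight, cexp_ptLeft, ofReal_chi, mul_pow, mul_pow]
  ring

lemma hasSum_chi_sigma :
    HasSum (fun n : ℕ ↦ ((chi n * ((σ 7 n - n ^ 2 * σ 5 n) * Real.exp (-(π / 2)) ^ n) : ℝ) : ℂ))
      (D (D E₆) ptRight / (1008 * I) - D (D E₆) ptLeft / (1008 * I)) := by
  have h8 := hasQExp_E₈.hasSum_chi.div_const 480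
  have h6 := hasQExp_E₆.derivative.derivative.hasSum_chi.div_const 504
  rw [E₈_eq, E₈_eq, E₄_ptRight, E₄_ptLeft] at h8
  convert! h8.add h6 using 1
  · ext n
    rcases eq_or_ne n 0 with rfl | hn
    · simp [chi]
    · simp only [hn, if_false]
      push_cast
      ring
  · ring

lemma hasSum_main : HasSum (fun n : ℕ ↦ chi n * ((σ 7 n - n ^ 2 * σ 5 n) *
      Real.exp (-(π / 2)) ^ n))
    (63 * Real.Gamma (1 / 4) ^ 12 / (2 ^ 8 * π ^ 11) -
      13 * Real.Gamma (1 / 4) ^ 20 / (2 ^ 14 * π ^ 15)) := by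
  rw [← Complex.hasSum_ofReal]
  have hG : 0 < Real.Gamma (1 / 4) := Real.Gamma_pos_of_pos (by norm_num)
  have hπ := Real.pi_pos
  have h0 := ofReal_pi_ne_zero'
  set G := Real.Gamma (1 / 4) with hGdef
  have hφ : E2 ptTwoI - 3 / (2 * π) = ((3 * G ^ 4 / (32 * π ^ 3) : ℝ) : ℂ) := by
    obtain ⟨p, hp, hpe⟩ := exists_E2_two_I
    have hsq := sq_E2_two_I
    rw [E₄_I, hpe] at hsq
    rw [hpe]
    have hsq' : (p - 3 / (2 * π)) ^ 2 = (3 * G ^ 4 / (32 * π ^ 3)) ^ 2 := by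
      rw [← hGdef] at hsq
      have : (p - 3 / (2 * π)) ^ 2 = 3 / 16 * (3 * G ^ 8 / (64 * π ^ 6)) := by
        apply ofReal_injective
        push_cast at hsq ⊢
        exact hsq
      rw [this]
      ring
    have hp' : 0 ≤ p - 3 / (2 * π) := by
      have : 3 / (2 * π) ≤ 3 / π := by gcongr; linarith
      linarith
    have := (pow_left_inj₀ hp' (by positivity) two_ne_zero).1 hsq'
    exact_mod_cast this
  have hG0 : (G : ℂ) ≠ 0 := by exact_mod_cast hG.ne'
  have hQ : E₄ ptTwoI = 33 * G ^ 8 / (1024 * π ^ 6) := by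
    rw [E₄_two_I, E₄_I, ← hGdef]
    push_cast
    ring
  have hR : E₆ ptTwoI = 189 * G ^ 12 / (32768 * π ^ 9) := by
    have h := E2_mul_E₆_two_I
    rw [hφ, E₄_I, ← hGdef] at h
    push_cast at h
    field_simp at h ⊢
    linear_combination h / 32
  convert! hasSum_chi_sigma using 1
  rw [deriv_deriv_E₆, deriv_deriv_E₆, E2_ptRight, E2_ptLeft, E₄_ptRight, E₄_ptLeft, E₆_ptRight,
    E₆_ptLeft, hφ, hQ, hR]
  push_cast
  field_simp
  ring_nf
  rw [I_pow_three]
  ring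

end SechCubed

theorem sum_odd_seventh_cosh_cubed :
    (∑' n : ℕ, (-1 : ℝ) ^ n * (2*(n:ℝ)+1) ^ 7 / Real.cosh ((2*(n:ℝ)+1) * π / 2) ^ 3) =
      63 * Real.Gamma (1/4) ^ 12 / (2 ^ 8 * π ^ 11)
    - 13 * Real.Gamma (1/4) ^ 20 / (2 ^ 14 * π ^ 15) := by
  exact (SechCubed.hasSum_div_cosh_cubed SechCubed.hasSum_main).tsum_eq
end
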